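/- Let K be an algebraically closed field of characteristic 0, G a reductive group over K, H a closed subgroup of G of maximal reductive rank, and K' a normal closed subgroup of H with H/K' isomorphic to G_a. Then a contradiction follows; i.e., no such K' exists. -/

import Mathlib

open Matrix MvPolynomial

variable {K : Type} [Field K]

/-- The entries and inverse-entries of an element of `GL (Fin n) K`, as a valuation of
variables; used to express Zariski-closedness and polynomiality on `GL n`. -/
def matOf {n : ℕ} (A : GL (Fin n) K) : (Fin n × Fin n) ⊕ (Fin n × Fin n) → K :=
  Sum.elim (fun q => (A : Matrix (Fin n) (Fin n) K) q.1 q.2)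
           (fun q => ((A⁻¹ : GL (Fin n) K) : Matrix (Fin n) (Fin n) K) q.1 q.2)

/-- A subset of `GL n K` is Zariski closed if it is the common zero locus of a family of
polynomials in the matrix entries and the entries of the inverse matrix. -/
def IsZClosed {n : ℕ} (s : Set (GL (Fin n) K)) : Prop :=
  ∃ I : Set (MvPolynomial ((Fin n × Fin n) ⊕ (Fin n × Fin n)) K),
    s = {A | ∀ p ∈ I, eval (matOf A) p = 0}

/-- A subgroup of `GL n K` is connected (for the Zariski topology). -/
def IsConnectedSG {n : ℕ} (H : Subgroup (GL (Fin n) K)) : Prop :=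
  ∀ s t : Set (GL (Fin n) K), IsZClosed s → IsZClosed t →
    (H : Set (GL (Fin n) K)) ⊆ s ∪ t → (H : Set (GL (Fin n) K)) ∩ s ∩ t = ∅ →
    (H : Set (GL (Fin n) K)) ⊆ s ∨ (H : Set (GL (Fin n) K)) ⊆ t

/-- A function on a subgroup of `GL n K` is a polynomial (regular) function if it is given by
a polynomial in the matrix entries and inverse-matrix entries. -/
def IsPolyFun {n : ℕ} (H : Subgroup (GL (Fin n) K)) (f : H → K) : Prop :=
  ∃ p : MvPolynomial ((Fin n × Fin n) ⊕ (Fin n × Fin n)) K,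
    ∀ A : H, f A = eval (matOf (A : GL (Fin n) K)) p

/-- A homomorphism of linear algebraic groups: a group homomorphism which is regular. -/
structure AlgGroupHom {n m : ℕ} (H : Subgroup (GL (Fin n) K)) (H' : Subgroup (GL (Fin m) K)) where
  toFun : H →* H'
  poly : ∀ i j : Fin m,
    IsPolyFun H (fun A => ((toFun A : GL (Fin m) K) : Matrix (Fin m) (Fin m) K) i j)

/-- A homomorphism of algebraic groups from `H` to the additive group `G_a`. -/
structure GaHom {n : ℕ} (H : Subgroup (GL (Fin n) K)) where
  toFun : H → K
  map_mul : ∀ A B : H, toFun (A * B) = toFun A + toFun B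
  poly : IsPolyFun H toFun

/-- Base change `GL n K → GL n K̄`. -/
noncomputable def glBaseChange {n : ℕ} : GL (Fin n) K →* GL (Fin n) (AlgebraicClosure K) :=
  Units.map ((algebraMap K (AlgebraicClosure K)).mapMatrix.toMonoidHom)

/-- A torus: a Zariski-closed connected subgroup which is diagonalizable over the algebraic
closure. -/
def IsTorus {n : ℕ} (T : Subgroup (GL (Fin n) K)) : Prop :=
  IsZClosed (T : Set (GL (Fin n) K)) ∧ IsConnectedSG T ∧
  ∃ g : GL (Fin n) (AlgebraicClosure K), ∀ A ∈ T,
    Matrix.IsDiag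
      ((g * glBaseChange A * g⁻¹ : GL (Fin n) (AlgebraicClosure K)) :
        Matrix (Fin n) (Fin n) (AlgebraicClosure K))

/-- `T` is a maximal torus of `G`. -/
def IsMaximalTorus {n : ℕ} (G T : Subgroup (GL (Fin n) K)) : Prop :=
  IsTorus T ∧ T ≤ G ∧
    ∀ T' : Subgroup (GL (Fin n) K), IsTorus T' → T' ≤ G → T ≤ T' → T' = T

/-- A unipotent element of `GL n K`. -/
def IsUnipotentElt {n : ℕ} (A : GL (Fin n) K) : Prop :=
  ((A : Matrix (Fin n) (Fin n) K) - 1) ^ n = 0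

/-- A (connected) reductive group: closed, connected, with trivial unipotent radical, i.e.
every Zariski-closed connected normal subgroup consisting of unipotent elements is trivial. -/
def IsReductive {n : ℕ} (G : Subgroup (GL (Fin n) K)) : Prop :=
  IsZClosed (G : Set (GL (Fin n) K)) ∧ IsConnectedSG G ∧
  ∀ U : Subgroup (GL (Fin n) K), U ≤ G → IsZClosed (U : Set (GL (Fin n) K)) →
    IsConnectedSG U → (∀ g ∈ G, ∀ u ∈ U, g * u * g⁻¹ ∈ U) →
    (∀ u ∈ U, IsUnipotentElt u) → U = ⊥

/-- A torus has rank `r` if it is isomorphic, as an algebraic group, to `G_m^r`. -/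
def TorusHasRank {n : ℕ} (T : Subgroup (GL (Fin n) K)) (r : ℕ) : Prop :=
  ∃ e : T ≃* (Fin r → Kˣ),
    (∀ i : Fin r, IsPolyFun T (fun A => ((e A i : Kˣ) : K))) ∧
    (∀ i j : Fin n, ∃ p : MvPolynomial (Fin r ⊕ Fin r) K, ∀ v : Fin r → Kˣ,
      (((e.symm v : T) : GL (Fin n) K) : Matrix (Fin n) (Fin n) K) i j =
        eval (Sum.elim (fun k => ((v k : Kˣ) : K)) (fun k => (((v k)⁻¹ : Kˣ) : K))) p)

/-- The reductive rank of `G` is `r`: some maximal torus of `G` has rank `r`. -/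
def HasRedRank {n : ℕ} (G : Subgroup (GL (Fin n) K)) (r : ℕ) : Prop :=
  ∃ T : Subgroup (GL (Fin n) K), IsMaximalTorus G T ∧ TorusHasRank T r

section Abstract

variable {V : Type*} [AddCommGroup V] [Module K V]

theorem mem_of_sum_maxGenEigenspace_mem {F : Module.End K V} {I : Submodule K V}
    (hI : ∀ x ∈ I, F x ∈ I) (m : K →₀ V) (hm : ∀ ν, m ν ∈ F.maxGenEigenspace ν)
    (hs : (m.sum fun _ v => v) ∈ I) (ν : K) : m ν ∈ I := by
  classical
  have hI' : I ≤ I.comap F := hI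
  let F' : Module.End K (V ⧸ I) := I.mapQ I F hI'
  have hpow : ∀ (ν : K) (k : ℕ) (v : V),
      ((F' - ν • 1) ^ k) (I.mkQ v) = I.mkQ (((F - ν • 1) ^ k) v) := by
    intro ν k
    induction k with
    | zero => intro v; simp
    | succ k ih =>
      intro v
      rw [pow_succ, pow_succ, Module.End.mul_apply, Module.End.mul_apply, ← ih]
      congr 1
  have hmem : ∀ ν, I.mkQ (m ν) ∈ F'.maxGenEigenspace ν := by
    intro ν
    have := hm ν
    rw [Module.End.mem_maxGenEigenspace] at this ⊢
    obtain ⟨k, hk⟩ := this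
    exact ⟨k, by rw [hpow, hk, map_zero]⟩
  have hind := F'.independent_maxGenEigenspace
  have h0 : ∑ ν ∈ m.support, I.mkQ (m ν) = 0 := by
    rw [← map_sum]
    exact (Submodule.Quotient.mk_eq_zero I).2 hs
  rw [← Submodule.Quotient.mk_eq_zero I]
  by_cases hν : ν ∈ m.support
  · have := (iSupIndep_iff_forall_dfinsupp _).1 hind
    have hd := hind ν
    rw [Submodule.disjoint_def] at hd
    refine hd _ (hmem ν) ?_
    rw [← Finset.add_sum_erase _ _ hν] at h0
    rw [show Submodule.Quotient.mk (m ν) = -∑ x ∈ m.support.erase ν, I.mkQ (m x) from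
      eq_neg_of_add_eq_zero_left h0]
    refine neg_mem (sum_mem fun x hx => ?_)
    exact Submodule.mem_iSup_of_mem x
      (Submodule.mem_iSup_of_mem (Finset.ne_of_mem_erase hx) (hmem x))
  · rw [Finsupp.notMem_support_iff.1 hν]; rfl

theorem stable_of_iSup_inf_eigenspace {F Θ : Module.End K V} (κ : K → K)
    (htop : ⨆ ν, F.maxGenEigenspace ν ⊓ Θ.eigenspace (κ ν) = ⊤) {I : Submodule K V}
    (hI : ∀ x ∈ I, F x ∈ I) : ∀ x ∈ I, Θ x ∈ I := by
  intro x hx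
  obtain ⟨m, hm, rfl⟩ := (Submodule.mem_iSup_iff_exists_finsupp _ _).1 (htop ▸ Submodule.mem_top :
    x ∈ ⨆ ν, F.maxGenEigenspace ν ⊓ Θ.eigenspace (κ ν))
  have h := mem_of_sum_maxGenEigenspace_mem hI m (fun ν => (hm ν).1) hx
  rw [map_finsuppSum]
  refine sum_mem fun ν _ => ?_
  simp only [Module.End.mem_eigenspace_iff.1 (hm ν).2]
  exact I.smul_mem _ (h ν)

theorem apply_mem_of_apply_apply_mem {F : Module.End K V}
    (htop : ⨆ ν, F.eigenspace ν = ⊤) {I : Submodule K V}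
    (hI : ∀ x ∈ I, F x ∈ I) {p : V} (hp : F (F p) ∈ I) : F p ∈ I := by
  obtain ⟨m, hm, rfl⟩ := (Submodule.mem_iSup_iff_exists_finsupp _ _).1 (htop ▸ Submodule.mem_top :
    p ∈ ⨆ ν, F.eigenspace ν)
  have hF : ∀ ν, F (m ν) = ν • m ν := fun ν => Module.End.mem_eigenspace_iff.1 (hm ν)
  have hm' : ∀ ν, m ν ∈ F.maxGenEigenspace ν := fun ν =>
    (Module.End.mem_maxGenEigenspace _ _ _).2 ⟨1, by simp [hF]⟩
  let m' : K →₀ V := Finsupp.onFinset m.support (fun ν => ν • ν • m ν)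
    (fun ν h => by rw [Finsupp.mem_support_iff]; rintro h0; simp [h0] at h)
  have hsum : (m'.sum fun _ v => v) = F (F (m.sum fun _ v => v)) := by
    rw [Finsupp.onFinset_sum _ (fun _ => rfl), map_finsuppSum, map_finsuppSum]
    simp [Finsupp.sum, hF]
  have key := mem_of_sum_maxGenEigenspace_mem hI m'
    (fun ν => Submodule.smul_mem _ _ (Submodule.smul_mem _ _ (hm' ν))) (hsum ▸ hp)
  rw [map_finsuppSum]
  refine sum_mem fun ν _ => ?_
  simp only [hF]
  by_cases hν : ν = 0
  · simp [hν]
  · have : ν • m ν = ν⁻¹ • (ν • ν • m ν) := (inv_smul_smul₀ hν _).symm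
    rw [this]
    exact I.smul_mem _ (key ν)

theorem mem_maxGenEigenspace_of_commute {F E Δ : Module.End K V} (hF : F = E + Δ)
    (hc : Commute E Δ) {v : V} {μ : K} (hv : E v = μ • v) (hΔ : ∃ k, (Δ ^ k) v = 0) :
    v ∈ F.maxGenEigenspace μ := by
  have h1 : v ∈ E.maxGenEigenspace μ := (Module.End.mem_maxGenEigenspace _ _ _).2
    ⟨1, by simp [hv]⟩
  have h2 : v ∈ Δ.maxGenEigenspace 0 := (Module.End.mem_maxGenEigenspace _ _ _).2
    (by simpa using hΔ)
  have := Module.End.genEigenspace_inf_le_add E Δ μ 0 ⊤ ⊤ hc ⟨h1, h2⟩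
  rw [hF]
  simpa [Module.End.maxGenEigenspace] using this

theorem maxGenEigenspace_eq_eigenspace_of_iSup_eq_top {θ : Module.End K V}
    (h : ⨆ ν, θ.eigenspace ν = ⊤) (μ : K) : θ.maxGenEigenspace μ = θ.eigenspace μ := by
  refine le_antisymm (fun v hv => ?_) (θ.genEigenspace_le_maximal μ 1)
  have htop : ⨆ ν, Module.End.eigenspace (θ - μ • (1 : Module.End K V)) ν = ⊤ := by
    rw [eq_top_iff, ← h]
    refine iSup_le fun ν w hw => Submodule.mem_iSup_of_mem (ν - μ) ?_
    refine Module.End.mem_eigenspace_iff.2 ?_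
    rw [LinearMap.sub_apply, Module.End.mem_eigenspace_iff.1 hw, sub_smul]
    rfl
  obtain ⟨k, hk⟩ := (Module.End.mem_maxGenEigenspace _ _ _).1 hv
  rw [Module.End.mem_eigenspace_iff, ← sub_eq_zero]
  change (θ - μ • (1 : Module.End K V)) v = 0
  induction k generalizing v with
  | zero =>
    rw [pow_zero, Module.End.one_apply] at hk
    rw [hk, map_zero]
  | succ k ih =>
    rw [pow_succ, Module.End.mul_apply] at hk
    refine (Submodule.mem_bot K).1 (apply_mem_of_apply_apply_mem htop (by simp) ?_)
    exact (Submodule.mem_bot K).2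
      (ih _ ((Module.End.mem_maxGenEigenspace _ _ _).2 ⟨k, hk⟩) hk)

end Abstract

section Poly

variable {n : ℕ}

/-- The ring of polynomials in the entries of a matrix and of its inverse. -/
abbrev CoordPoly (K : Type) [Field K] (n : ℕ) : Type :=
  MvPolynomial ((Fin n × Fin n) ⊕ (Fin n × Fin n)) K

/-- The generic matrix. -/
noncomputable def genMat (K : Type) [Field K] (n : ℕ) : Matrix (Fin n) (Fin n) (CoordPoly K n) :=
  Matrix.of fun i j => X (Sum.inl (i, j))

/-- The generic inverse matrix. -/
noncomputable def genInv (K : Type) [Field K] (n : ℕ) : Matrix (Fin n) (Fin n) (CoordPoly K n) :=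
  Matrix.of fun i j => X (Sum.inr (i, j))

/-- Scalar matrices viewed as matrices of constant polynomials. -/
noncomputable def constMat : Matrix (Fin n) (Fin n) K →+* Matrix (Fin n) (Fin n) (CoordPoly K n) :=
  (C : K →+* CoordPoly K n).mapMatrix

@[simp] theorem constMat_apply (M : Matrix (Fin n) (Fin n) K) (i j : Fin n) :
    constMat M i j = C (M i j) := rfl

/-- The left invariant derivation attached to a matrix. -/
noncomputable def leftDer (A : Matrix (Fin n) (Fin n) K) :
    Derivation K (CoordPoly K n) (CoordPoly K n) :=
  mkDerivation K (Sum.elim (fun q => (genMat K n * constMat A) q.1 q.2)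
    (fun q => -(constMat A * genInv K n) q.1 q.2))

/-- Right translation by an element of `GL n K`. -/
noncomputable def rightTrans (g : GL (Fin n) K) : CoordPoly K n →ₐ[K] CoordPoly K n :=
  aeval (Sum.elim (fun q => (genMat K n * constMat (g : Matrix (Fin n) (Fin n) K)) q.1 q.2)
    (fun q => (constMat ((g⁻¹ : GL (Fin n) K) : Matrix (Fin n) (Fin n) K) * genInv K n) q.1 q.2))

theorem leftDer_genMat_mul (A M : Matrix (Fin n) (Fin n) K) (i j : Fin n) :
    leftDer A ((genMat K n * constMat M) i j) = (genMat K n * constMat (A * M)) i j := by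
  have h : ∀ i j, leftDer A (genMat K n i j) = (genMat K n * constMat A) i j := by
    intro i j
    simp [genMat, leftDer, mkDerivation_X]
  rw [map_mul, ← Matrix.mul_assoc, Matrix.mul_apply, Matrix.mul_apply]
  simp [Derivation.leibniz, h, mul_comm]

theorem leftDer_mul_genInv (A M : Matrix (Fin n) (Fin n) K) (i j : Fin n) :
    leftDer A ((constMat M * genInv K n) i j) = -(constMat (M * A) * genInv K n) i j := by
  have h : ∀ i j, leftDer A (genInv K n i j) = -(constMat A * genInv K n) i j := by
    intro i j
    simp [genInv, leftDer, mkDerivation_X]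
  rw [map_mul, Matrix.mul_assoc, Matrix.mul_apply, Matrix.mul_apply]
  simp [Derivation.leibniz, h]

theorem rightTrans_genMat_mul (g : GL (Fin n) K) (M : Matrix (Fin n) (Fin n) K) (i j : Fin n) :
    rightTrans g ((genMat K n * constMat M) i j) =
      (genMat K n * constMat ((g : Matrix (Fin n) (Fin n) K) * M)) i j := by
  have h : ∀ i j, rightTrans g (genMat K n i j) =
      (genMat K n * constMat (g : Matrix (Fin n) (Fin n) K)) i j := by
    intro i j
    simp [genMat, rightTrans]
  rw [map_mul, ← Matrix.mul_assoc, Matrix.mul_apply, Matrix.mul_apply]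
  simp [h, ← algebraMap_eq]

theorem rightTrans_mul_genInv (g : GL (Fin n) K) (M : Matrix (Fin n) (Fin n) K) (i j : Fin n) :
    rightTrans g ((constMat M * genInv K n) i j) =
      (constMat (M * ((g⁻¹ : GL (Fin n) K) : Matrix (Fin n) (Fin n) K)) * genInv K n) i j := by
  have h : ∀ i j, rightTrans g (genInv K n i j) =
      (constMat ((g⁻¹ : GL (Fin n) K) : Matrix (Fin n) (Fin n) K) * genInv K n) i j := by
    intro i j
    simp [genInv, rightTrans]
  rw [map_mul, Matrix.mul_assoc, Matrix.mul_apply, Matrix.mul_apply]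
  simp [h, ← algebraMap_eq]

theorem leftDer_X_inl (A : Matrix (Fin n) (Fin n) K) (i j : Fin n) :
    leftDer A (X (Sum.inl (i, j))) = (genMat K n * constMat A) i j := by
  simp [leftDer, mkDerivation_X]

theorem leftDer_X_inr (A : Matrix (Fin n) (Fin n) K) (i j : Fin n) :
    leftDer A (X (Sum.inr (i, j))) = -(constMat A * genInv K n) i j := by
  simp [leftDer, mkDerivation_X]

theorem rightTrans_X_inl (g : GL (Fin n) K) (i j : Fin n) :
    rightTrans g (X (Sum.inl (i, j))) =
      (genMat K n * constMat (g : Matrix (Fin n) (Fin n) K)) i j := by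
  simp [rightTrans]

theorem rightTrans_X_inr (g : GL (Fin n) K) (i j : Fin n) :
    rightTrans g (X (Sum.inr (i, j))) =
      (constMat ((g⁻¹ : GL (Fin n) K) : Matrix (Fin n) (Fin n) K) * genInv K n) i j := by
  simp [rightTrans]

/-- The diagonal matrix with given invertible entries. -/
def diagGL (c : Fin n → Kˣ) : GL (Fin n) K where
  val := Matrix.diagonal fun i => (c i : K)
  inv := Matrix.diagonal fun i => ((c i)⁻¹ : Kˣ)
  val_inv := by simp [Matrix.diagonal_mul_diagonal]
  inv_val := by simp [Matrix.diagonal_mul_diagonal]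

/-- The polynomials of weight `α` for the torus of matrices diagonalized by `P`. -/
noncomputable def weightSpace (P : GL (Fin n) K) (α : Fin n → ℤ) :
    Submodule K (CoordPoly K n) :=
  (⨅ e : Fin n → K, Module.End.eigenspace
    (leftDer ((P : Matrix (Fin n) (Fin n) K) * Matrix.diagonal e *
      ((P⁻¹ : GL (Fin n) K) : Matrix (Fin n) (Fin n) K)) : Module.End K (CoordPoly K n))
    (∑ i, (α i : K) * e i)) ⊓
  ⨅ c : Fin n → Kˣ, Module.End.eigenspace
    (rightTrans (P * diagGL c * P⁻¹)).toLinearMap ((∏ i, c i ^ α i : Kˣ) : K)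

theorem mem_weightSpace {P : GL (Fin n) K} {α : Fin n → ℤ} {a : CoordPoly K n} :
    a ∈ weightSpace P α ↔
      (∀ e : Fin n → K, leftDer ((P : Matrix (Fin n) (Fin n) K) * Matrix.diagonal e *
        ((P⁻¹ : GL (Fin n) K) : Matrix (Fin n) (Fin n) K)) a = (∑ i, (α i : K) * e i) • a) ∧
      ∀ c : Fin n → Kˣ,
        rightTrans (P * diagGL c * P⁻¹) a = ((∏ i, c i ^ α i : Kˣ) : K) • a := by
  simp [weightSpace, Submodule.mem_iInf]

theorem mul_mem_weightSpace {P : GL (Fin n) K} {α β : Fin n → ℤ} {a b : CoordPoly K n}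
    (ha : a ∈ weightSpace P α) (hb : b ∈ weightSpace P β) : a * b ∈ weightSpace P (α + β) := by
  rw [mem_weightSpace] at *
  refine ⟨fun e => ?_, fun c => ?_⟩
  · rw [Derivation.leibniz, ha.1, hb.1]
    simp only [Pi.add_apply, Int.cast_add, add_mul, Finset.sum_add_distrib, smul_eq_mul,
      add_smul, mul_smul_comm]
    rw [mul_comm b a, add_comm]
  · rw [map_mul, ha.2, hb.2, smul_mul_smul_comm]
    simp only [Pi.add_apply, _root_.zpow_add, Finset.prod_mul_distrib, Units.val_mul]

theorem one_mem_weightSpace (P : GL (Fin n) K) : 1 ∈ weightSpace P 0 := by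
  rw [mem_weightSpace]
  simp

theorem mul_diag_entry (M : Matrix (Fin n) (Fin n) (CoordPoly K n)) (e : Fin n → K) (i k : Fin n) :
    (M * constMat (Matrix.diagonal e)) i k = e k • M i k := by
  have : constMat (Matrix.diagonal e) = Matrix.diagonal fun i => (C (e i) : CoordPoly K n) := by
    ext1 i j
    by_cases h : i = j <;> simp [h]
  rw [this, Matrix.mul_diagonal, mul_comm, C_mul']

theorem diag_mul_entry (M : Matrix (Fin n) (Fin n) (CoordPoly K n)) (e : Fin n → K) (i k : Fin n) :
    (constMat (Matrix.diagonal e) * M) i k = e i • M i k := by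
  have : constMat (Matrix.diagonal e) = Matrix.diagonal fun i => (C (e i) : CoordPoly K n) := by
    ext1 i j
    by_cases h : i = j <;> simp [h]
  rw [this, Matrix.diagonal_mul, C_mul']

theorem genMat_mul_mem_weightSpace (P : GL (Fin n) K) (i k : Fin n) :
    (genMat K n * constMat (P : Matrix (Fin n) (Fin n) K)) i k ∈
      weightSpace P (Pi.single k 1) := by
  rw [mem_weightSpace]
  refine ⟨fun e => ?_, fun c => ?_⟩
  · rw [leftDer_genMat_mul, mul_assoc, Units.inv_mul, mul_one, map_mul, ← Matrix.mul_assoc,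
      mul_diag_entry]
    simp [Pi.single_apply]
  · rw [rightTrans_genMat_mul]
    simp only [Units.val_mul, mul_assoc, Units.inv_mul, mul_one, map_mul]
    rw [← Matrix.mul_assoc, diagGL, mul_diag_entry]
    simp [Pi.single_apply, apply_ite, Finset.prod_ite_eq']

theorem mul_genInv_mem_weightSpace (P : GL (Fin n) K) (k j : Fin n) :
    (constMat ((P⁻¹ : GL (Fin n) K) : Matrix (Fin n) (Fin n) K) * genInv K n) k j ∈
      weightSpace P (Pi.single k (-1)) := by
  rw [mem_weightSpace]
  refine ⟨fun e => ?_, fun c => ?_⟩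
  · rw [leftDer_mul_genInv, mul_assoc, ← mul_assoc, Units.inv_mul, one_mul, map_mul,
      Matrix.mul_assoc, diag_mul_entry]
    simp [Pi.single_apply]
  · rw [rightTrans_mul_genInv]
    have : ((P⁻¹ : GL (Fin n) K) : Matrix (Fin n) (Fin n) K) *
        (((P * diagGL c * P⁻¹)⁻¹ : GL (Fin n) K) : Matrix (Fin n) (Fin n) K) =
        Matrix.diagonal (fun i => (((c i)⁻¹ : Kˣ) : K)) *
          ((P⁻¹ : GL (Fin n) K) : Matrix (Fin n) (Fin n) K) := by
      rw [← Units.val_mul, _root_.mul_inv_rev, _root_.mul_inv_rev, inv_inv, ← mul_assoc, ← mul_assoc,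
        inv_mul_cancel, one_mul, Units.val_mul]
      rfl
    rw [this, map_mul, Matrix.mul_assoc, diag_mul_entry]
    simp [Pi.single_apply, apply_ite]

theorem iSup_weightSpace (P : GL (Fin n) K) : ⨆ α, weightSpace P α = ⊤ := by
  set S := ⨆ α, weightSpace P α with hS
  have hle : ∀ α, weightSpace P α ≤ S := le_iSup _
  have h1 : (1 : CoordPoly K n) ∈ S := hle 0 (one_mem_weightSpace P)
  have hmul : ∀ a ∈ S, ∀ b ∈ S, a * b ∈ S := by
    intro a ha b hb
    refine Submodule.iSup_induction _ (motive := fun a => a * b ∈ S) ha (fun α x hx => ?_)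
      (by simp) (fun x y hx hy => by rw [add_mul]; exact S.add_mem hx hy)
    refine Submodule.iSup_induction _ (motive := fun b => x * b ∈ S) hb (fun β y hy => ?_)
      (by simp) (fun y z hy hz => by rw [mul_add]; exact S.add_mem hy hz)
    exact hle _ (mul_mem_weightSpace hx hy)
  rw [eq_top_iff]
  intro p _
  induction p using MvPolynomial.induction_on with
  | C r =>
    rw [← mul_one (C r), C_mul']
    exact S.smul_mem _ h1
  | add p q hp hq => exact S.add_mem (hp trivial) (hq trivial)
  | mul_X p v hp =>
    refine hmul _ (hp trivial) _ ?_
    rcases v with ⟨i, j⟩ | ⟨i, j⟩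
    · have : (X (Sum.inl (i, j)) : CoordPoly K n) =
          ((genMat K n * constMat (P : Matrix (Fin n) (Fin n) K)) *
            constMat ((P⁻¹ : GL (Fin n) K) : Matrix (Fin n) (Fin n) K)) i j := by
        rw [Matrix.mul_assoc, ← map_mul, Units.mul_inv, map_one, Matrix.mul_one]
        rfl
      rw [this, Matrix.mul_apply]
      refine sum_mem fun k _ => ?_
      rw [constMat_apply, mul_comm, C_mul']
      exact S.smul_mem _ (hle _ (genMat_mul_mem_weightSpace P i k))
    · have : (X (Sum.inr (i, j)) : CoordPoly K n) =
          (constMat (P : Matrix (Fin n) (Fin n) K) *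
            (constMat ((P⁻¹ : GL (Fin n) K) : Matrix (Fin n) (Fin n) K) * genInv K n)) i j := by
        rw [← Matrix.mul_assoc, ← map_mul, Units.mul_inv, map_one, Matrix.one_mul]
        rfl
      rw [this, Matrix.mul_apply]
      refine sum_mem fun k _ => ?_
      rw [constMat_apply, C_mul']
      exact S.smul_mem _ (hle _ (mul_genInv_mem_weightSpace P k j))

end Poly

section LocallyNilpotent

variable {n : ℕ}

theorem locally_nilpotent_mul {A : Type*} [CommRing A] [Algebra K A] {Δ σ : Module.End K A}
    (hc : Commute Δ σ) (hmul : ∀ a b, Δ (a * b) = Δ a * σ b + a * Δ b) :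
    ∀ (m k l : ℕ), k + l = m → ∀ a b : A, (Δ ^ k) a = 0 → (Δ ^ l) b = 0 → (Δ ^ m) (a * b) = 0 := by
  intro m
  induction m with
  | zero =>
    intro k l hkl a b ha hb
    obtain ⟨rfl, rfl⟩ : k = 0 ∧ l = 0 := by omega
    simp_all
  | succ m ih =>
    intro k l hkl a b ha hb
    rw [pow_succ, Module.End.mul_apply, hmul, map_add]
    have hσ : (Δ ^ l) (σ b) = 0 := by
      rw [← Module.End.mul_apply, (hc.pow_left l).eq, Module.End.mul_apply, hb, map_zero]
    have h1 : (Δ ^ m) (Δ a * σ b) = 0 := by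
      rcases k with _ | k
      · have : a = 0 := by simpa using ha
        simp [this]
      · exact ih k l (by omega) _ _ (by rwa [pow_succ, Module.End.mul_apply] at ha) hσ
    have h2 : (Δ ^ m) (a * Δ b) = 0 := by
      rcases l with _ | l
      · have : b = 0 := by simpa using hb
        simp [this]
      · exact ih k l (by omega) _ _ ha (by rwa [pow_succ, Module.End.mul_apply] at hb)
    rw [h1, h2, add_zero]

theorem locally_nilpotent_of_X {Δ σ : Module.End K (CoordPoly K n)}
    (hc : Commute Δ σ) (hmul : ∀ a b, Δ (a * b) = Δ a * σ b + a * Δ b)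
    (hC : ∀ r, Δ (C r) = 0) (hX : ∀ v, ∃ k, (Δ ^ k) (X v) = 0) (p : CoordPoly K n) :
    ∃ k, (Δ ^ k) p = 0 := by
  induction p using MvPolynomial.induction_on with
  | C r => exact ⟨1, by simpa using hC r⟩
  | add p q hp hq =>
    obtain ⟨k, hk⟩ := hp
    obtain ⟨l, hl⟩ := hq
    refine ⟨k + l, ?_⟩
    rw [map_add, pow_add, Module.End.mul_apply, Module.End.mul_apply, hl, map_zero, add_zero,
      ← Module.End.mul_apply, ← pow_add, add_comm, pow_add, Module.End.mul_apply, hk, map_zero]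
  | mul_X p v hp =>
    obtain ⟨k, hk⟩ := hp
    obtain ⟨l, hl⟩ := hX v
    exact ⟨k + l, locally_nilpotent_mul hc hmul _ k l rfl _ _ hk hl⟩

theorem exists_leftDer_pow_eq_zero {N : Matrix (Fin n) (Fin n) K} (hN : IsNilpotent N)
    (p : CoordPoly K n) :
    ∃ k, ((leftDer N : Module.End K (CoordPoly K n)) ^ k) p = 0 := by
  obtain ⟨k, hk⟩ := hN
  refine locally_nilpotent_of_X (σ := 1) (Commute.one_right _) (fun a b => ?_)
    (fun r => by simp [derivation_C]) (fun v => ⟨k, ?_⟩) p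
  · simp [Derivation.leibniz, mul_comm, add_comm]
  · rcases v with ⟨i, j⟩ | ⟨i, j⟩
    · have : ∀ k, ((leftDer N : Module.End K (CoordPoly K n)) ^ k) (X (Sum.inl (i, j))) =
          (genMat K n * constMat (N ^ k)) i j := by
        intro k
        induction k with
        | zero => simp [genMat]
        | succ k ih =>
          rw [pow_succ', Module.End.mul_apply, ih, pow_succ', ← leftDer_genMat_mul]
          rfl
      rw [this, hk]
      simp
    · have : ∀ k, ((leftDer N : Module.End K (CoordPoly K n)) ^ k) (X (Sum.inr (i, j))) =
          (-1) ^ k * (constMat (N ^ k) * genInv K n) i j := by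
        intro k
        induction k with
        | zero => simp [genInv]
        | succ k ih =>
          have h1 : ((-1) ^ k : CoordPoly K n) = algebraMap K _ ((-1) ^ k) := by simp
          rw [pow_succ', Module.End.mul_apply, ih, h1, ← Algebra.smul_def, map_smul]
          change (-1 : K) ^ k • leftDer N _ = _
          rw [leftDer_mul_genInv, pow_succ N, Algebra.smul_def, ← h1]
          ring
      rw [this, hk]
      simp

theorem isNilpotent_inv_sub_one {u : GL (Fin n) K}
    (hu : IsNilpotent ((u : Matrix (Fin n) (Fin n) K) - 1)) :
    IsNilpotent (((u⁻¹ : GL (Fin n) K) : Matrix (Fin n) (Fin n) K) - 1) := by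
  have h : ((u⁻¹ : GL (Fin n) K) : Matrix (Fin n) (Fin n) K) - 1 =
      -(((u⁻¹ : GL (Fin n) K) : Matrix (Fin n) (Fin n) K) *
        ((u : Matrix (Fin n) (Fin n) K) - 1)) := by
    rw [mul_sub, Units.inv_mul]; simp
  rw [h]
  refine (Commute.isNilpotent_mul_left ?_ hu).neg
  rw [commute_iff_eq, mul_sub, sub_mul, Units.inv_mul, Units.mul_inv, mul_one, one_mul]

theorem exists_rightTrans_sub_one_pow_eq_zero {u : GL (Fin n) K}
    (hu : IsNilpotent ((u : Matrix (Fin n) (Fin n) K) - 1)) (p : CoordPoly K n) :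
    ∃ k, (((rightTrans u).toLinearMap - 1 : Module.End K (CoordPoly K n)) ^ k) p = 0 := by
  have hu' := isNilpotent_inv_sub_one hu
  obtain ⟨k, hk⟩ := hu
  obtain ⟨l, hl⟩ := hu'
  refine locally_nilpotent_of_X (σ := (rightTrans u).toLinearMap) ?_ (fun a b => ?_)
    (fun r => by simp [← algebraMap_eq]) (fun v => ?_) p
  · exact (Commute.refl _).sub_left (Commute.one_left _)
  · simp only [LinearMap.sub_apply, AlgHom.toLinearMap_apply, map_mul, Module.End.one_apply]
    ring
  · rcases v with ⟨i, j⟩ | ⟨i, j⟩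
    · have : ∀ k, (((rightTrans u).toLinearMap - 1 : Module.End K (CoordPoly K n)) ^ k)
          (X (Sum.inl (i, j))) =
          (genMat K n * constMat (((u : Matrix (Fin n) (Fin n) K) - 1) ^ k) :
            Matrix (Fin n) (Fin n) (CoordPoly K n)) i j := by
        intro k
        induction k with
        | zero => simp [genMat]
        | succ k ih =>
          rw [pow_succ', Module.End.mul_apply, ih, pow_succ', sub_mul _ _ (_ ^ k), map_sub,
            mul_sub, Matrix.sub_apply, ← rightTrans_genMat_mul]
          simp
      exact ⟨k, by rw [this, hk]; simp⟩
    · have : ∀ k, (((rightTrans u).toLinearMap - 1 : Module.End K (CoordPoly K n)) ^ k)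
          (X (Sum.inr (i, j))) =
          (constMat ((((u⁻¹ : GL (Fin n) K) : Matrix (Fin n) (Fin n) K) - 1) ^ k) *
            genInv K n : Matrix (Fin n) (Fin n) (CoordPoly K n)) i j := by
        intro k
        induction k with
        | zero => simp [genInv]
        | succ k ih =>
          rw [pow_succ', Module.End.mul_apply, ih, pow_succ, mul_sub (_ ^ k), map_sub,
            sub_mul, Matrix.sub_apply, ← rightTrans_mul_genInv]
          simp
      exact ⟨l, by rw [this, hl]; simp⟩

end LocallyNilpotent

section Translation

variable {n : ℕ}

theorem leftDer_add (A B : Matrix (Fin n) (Fin n) K) :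
    leftDer (A + B) = leftDer A + leftDer B := by
  refine derivation_ext fun v => ?_
  rcases v with ⟨i, j⟩ | ⟨i, j⟩
  · simp [leftDer_X_inl, Matrix.mul_add]
  · simp [leftDer_X_inr, Matrix.add_mul, add_comm]

theorem leftDer_smul (c : K) (A : Matrix (Fin n) (Fin n) K) :
    leftDer (c • A) = c • leftDer A := by
  have h : constMat (c • A) = c • constMat A := by
    ext1 i j
    simp [C_mul']
  refine derivation_ext fun v => ?_
  rcases v with ⟨i, j⟩ | ⟨i, j⟩
  · simp [leftDer_X_inl, h]
  · simp [leftDer_X_inr, h]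

theorem leftDer_lie (A B : Matrix (Fin n) (Fin n) K) :
    leftDer ⁅A, B⁆ = ⁅leftDer A, leftDer B⁆ := by
  refine derivation_ext fun v => ?_
  rw [Derivation.commutator_apply, Ring.lie_def]
  rcases v with ⟨i, j⟩ | ⟨i, j⟩
  · simp only [leftDer_X_inl, leftDer_genMat_mul, map_sub, mul_sub, Matrix.sub_apply]
  · simp only [leftDer_X_inr, leftDer_mul_genInv, map_neg, map_sub, sub_mul, Matrix.sub_apply]
    ring

theorem leftDer_commute {A B : Matrix (Fin n) (Fin n) K} (h : Commute A B) :
    Commute (leftDer A : Module.End K (CoordPoly K n)) (leftDer B) := by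
  have h0 : leftDer ⁅A, B⁆ = 0 := by
    rw [Ring.lie_def, h.eq, sub_self]
    simpa using leftDer_smul (0 : K) (0 : Matrix (Fin n) (Fin n) K)
  rw [leftDer_lie] at h0
  rw [commute_iff_eq]
  refine LinearMap.ext fun p => ?_
  have := congrArg (fun D : Derivation K (CoordPoly K n) (CoordPoly K n) => D p) h0
  simp only [Derivation.commutator_apply, Derivation.coe_zero, Pi.zero_apply] at this
  exact sub_eq_zero.1 this

theorem rightTrans_mul (g h : GL (Fin n) K) :
    rightTrans (g * h) = (rightTrans g).comp (rightTrans h) := by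
  refine MvPolynomial.algHom_ext fun v => ?_
  rcases v with ⟨i, j⟩ | ⟨i, j⟩
  · simp only [AlgHom.comp_apply, rightTrans_X_inl, rightTrans_genMat_mul, Units.val_mul]
  · simp only [AlgHom.comp_apply, rightTrans_X_inr, rightTrans_mul_genInv, _root_.mul_inv_rev,
      Units.val_mul]

theorem rightTrans_leftDer (g : GL (Fin n) K) (A B : Matrix (Fin n) (Fin n) K)
    (h : B * (g : Matrix (Fin n) (Fin n) K) = g * A) (p : CoordPoly K n) :
    rightTrans g (leftDer A p) = leftDer B (rightTrans g p) := by
  have h' : ((g⁻¹ : GL (Fin n) K) : Matrix (Fin n) (Fin n) K) * B =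
      A * ((g⁻¹ : GL (Fin n) K) : Matrix (Fin n) (Fin n) K) := by
    rw [Units.inv_mul_eq_iff_eq_mul, ← mul_assoc, ← h, mul_assoc, Units.mul_inv, mul_one]
  induction p using MvPolynomial.induction_on with
  | C r => simp [derivation_C, ← algebraMap_eq]
  | add p q hp hq => simp only [map_add, hp, hq]
  | mul_X p v hp =>
    simp only [Derivation.leibniz, map_add, map_mul, smul_eq_mul, hp]
    congr 2
    rcases v with ⟨i, j⟩ | ⟨i, j⟩
    · rw [leftDer_X_inl, rightTrans_X_inl, rightTrans_genMat_mul, leftDer_genMat_mul, h]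
    · rw [leftDer_X_inr, rightTrans_X_inr, map_neg, rightTrans_mul_genInv, leftDer_mul_genInv, h']

theorem eval_rightTrans (A g : GL (Fin n) K) (p : CoordPoly K n) :
    eval (matOf A) (rightTrans g p) = eval (matOf (A * g)) p := by
  induction p using MvPolynomial.induction_on with
  | C r => simp [← algebraMap_eq]
  | add p q hp hq => simp only [map_add, hp, hq]
  | mul_X p v hp =>
    rw [map_mul, map_mul, map_mul, hp]
    congr 1
    rcases v with ⟨i, j⟩ | ⟨i, j⟩
    · rw [rightTrans_X_inl, Matrix.mul_apply, map_sum]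
      simp [genMat, matOf, Matrix.mul_apply]
    · rw [rightTrans_X_inr, Matrix.mul_apply, map_sum]
      simp [genInv, matOf, Matrix.mul_apply, _root_.mul_inv_rev, -Matrix.coe_units_inv]

/-- The polynomials vanishing on a set of invertible matrices. -/
def vanishing (s : Set (GL (Fin n) K)) : Submodule K (CoordPoly K n) where
  carrier := {p | ∀ A ∈ s, eval (matOf A) p = 0}
  add_mem' hp hq A hA := by rw [map_add, hp A hA, hq A hA, add_zero]
  zero_mem' A _ := map_zero _
  smul_mem' c p hp A hA := by rw [smul_eval, hp A hA, mul_zero]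

theorem IsZClosed.mem_of_vanishing {s : Set (GL (Fin n) K)} (hs : IsZClosed s)
    {A : GL (Fin n) K} (h : ∀ p ∈ vanishing s, eval (matOf A) p = 0) : A ∈ s := by
  obtain ⟨I, rfl⟩ := hs
  exact fun p hp => h p fun B hB => hB p hp

theorem rightTrans_mem_vanishing {G : Subgroup (GL (Fin n) K)} {g : GL (Fin n) K} (hg : g ∈ G) :
    ∀ p ∈ vanishing (G : Set (GL (Fin n) K)),
      (rightTrans g).toLinearMap p ∈ vanishing (G : Set (GL (Fin n) K)) := fun p hp A hA => by
  rw [AlgHom.toLinearMap_apply, eval_rightTrans]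
  exact hp _ (G.mul_mem hA hg)

theorem mem_of_rightTrans_mem_vanishing {G : Subgroup (GL (Fin n) K)}
    (hG : IsZClosed (G : Set (GL (Fin n) K))) {g : GL (Fin n) K}
    (h : ∀ p ∈ vanishing (G : Set (GL (Fin n) K)),
      (rightTrans g).toLinearMap p ∈ vanishing (G : Set (GL (Fin n) K))) : g ∈ G := by
  refine hG.mem_of_vanishing fun p hp => ?_
  rw [← one_mul g, ← eval_rightTrans]
  exact h p hp 1 G.one_mem

/-- The Lie algebra of a group of matrices: the matrices whose left invariant derivation preserves
the vanishing ideal. -/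
noncomputable def lieAlg (G : Subgroup (GL (Fin n) K)) :
    Submodule K (Matrix (Fin n) (Fin n) K) where
  carrier := {A | ∀ p ∈ vanishing (G : Set (GL (Fin n) K)),
    (leftDer A : Module.End K (CoordPoly K n)) p ∈ vanishing (G : Set (GL (Fin n) K))}
  add_mem' {A B} hA hB p hp := by
    rw [leftDer_add]
    exact Submodule.add_mem _ (hA p hp) (hB p hp)
  zero_mem' p hp := by
    have : leftDer (0 : Matrix (Fin n) (Fin n) K) = 0 := by
      simpa using leftDer_smul (0 : K) (0 : Matrix (Fin n) (Fin n) K)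
    rw [this]
    exact Submodule.zero_mem _
  smul_mem' c A hA p hp := by
    rw [leftDer_smul]
    exact Submodule.smul_mem _ c (hA p hp)

theorem mem_lieAlg {G : Subgroup (GL (Fin n) K)} {A : Matrix (Fin n) (Fin n) K} :
    A ∈ lieAlg G ↔ ∀ p ∈ vanishing (G : Set (GL (Fin n) K)),
      (leftDer A : Module.End K (CoordPoly K n)) p ∈ vanishing (G : Set (GL (Fin n) K)) := Iff.rfl

theorem lie_mem_lieAlg {G : Subgroup (GL (Fin n) K)} {A B : Matrix (Fin n) (Fin n) K}
    (hA : A ∈ lieAlg G) (hB : B ∈ lieAlg G) : ⁅A, B⁆ ∈ lieAlg G := by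
  rw [mem_lieAlg] at *
  intro p hp
  have : (leftDer ⁅A, B⁆ : Module.End K (CoordPoly K n)) p =
      leftDer A (leftDer B p) - leftDer B (leftDer A p) := by
    rw [leftDer_lie]
    exact Derivation.commutator_apply (D1 := leftDer A) (D2 := leftDer B) p
  rw [this]
  exact Submodule.sub_mem _ (hA _ (hB p hp)) (hB _ (hA p hp))

theorem conj_mem_lieAlg {G : Subgroup (GL (Fin n) K)} {g : GL (Fin n) K} (hg : g ∈ G)
    {A : Matrix (Fin n) (Fin n) K} (hA : A ∈ lieAlg G) :
    (g : Matrix (Fin n) (Fin n) K) * A * ((g⁻¹ : GL (Fin n) K) : Matrix (Fin n) (Fin n) K) ∈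
      lieAlg G := by
  rw [mem_lieAlg] at *
  intro p hp
  have h1 : p = rightTrans g (rightTrans g⁻¹ p) := by
    have h : rightTrans (1 : GL (Fin n) K) = AlgHom.id K _ := by
      refine MvPolynomial.algHom_ext fun v => ?_
      rcases v with ⟨i, j⟩ | ⟨i, j⟩
      · simp [rightTrans_X_inl, genMat]
      · simp [rightTrans_X_inr, genInv]
    have h' := DFunLike.congr_fun (rightTrans_mul g g⁻¹) p
    rw [mul_inv_cancel, h] at h'
    exact h'
  have h2 : (leftDer ((g : Matrix (Fin n) (Fin n) K) * A *
      ((g⁻¹ : GL (Fin n) K) : Matrix (Fin n) (Fin n) K)) : Module.End K (CoordPoly K n)) p =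
      rightTrans g (leftDer A (rightTrans g⁻¹ p)) := by
    rw [rightTrans_leftDer g A _ _, ← h1]
    · rfl
    · rw [mul_assoc, Units.inv_mul, mul_one]
  rw [h2]
  exact rightTrans_mem_vanishing hg _ (hA _ (rightTrans_mem_vanishing (G.inv_mem hg) _ hp))

end Translation

section Jordan

variable {n : ℕ}

/-- The matrix with eigenvalues `d` diagonalized by `P`. -/
def conjDiag (P : GL (Fin n) K) (d : Fin n → K) : Matrix (Fin n) (Fin n) K :=
  (P : Matrix (Fin n) (Fin n) K) * Matrix.diagonal d *
    ((P⁻¹ : GL (Fin n) K) : Matrix (Fin n) (Fin n) K)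

theorem leftDer_conjDiag_of_mem {P : GL (Fin n) K} {α : Fin n → ℤ} {a : CoordPoly K n}
    (ha : a ∈ weightSpace P α) (e : Fin n → K) :
    leftDer (conjDiag P e) a = (∑ i, (α i : K) * e i) • a :=
  (mem_weightSpace.1 ha).1 e

theorem weightSpace_le_maxGenEigenspace {P : GL (Fin n) K} {d : Fin n → K}
    {N : Matrix (Fin n) (Fin n) K} (hN : IsNilpotent N) (hc : Commute (conjDiag P d) N)
    (α : Fin n → ℤ) :
    weightSpace P α ≤ Module.End.maxGenEigenspace
      (leftDer (conjDiag P d + N) : Module.End K (CoordPoly K n)) (∑ i, (α i : K) * d i) :=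
  fun p hp => mem_maxGenEigenspace_of_commute (E := (leftDer (conjDiag P d) : Module.End K (CoordPoly K n)))
    (Δ := (leftDer N : Module.End K (CoordPoly K n)))
    (by rw [leftDer_add]; rfl) (leftDer_commute hc) (leftDer_conjDiag_of_mem hp d)
    (exists_leftDer_pow_eq_zero hN p)

theorem iSup_eq_top_of_weightSpace_le {ι : Type*} {P : GL (Fin n) K}
    {W : ι → Submodule K (CoordPoly K n)} (i : (Fin n → ℤ) → ι)
    (h : ∀ α, weightSpace P α ≤ W (i α)) : ⨆ ν, W ν = ⊤ := by
  rw [eq_top_iff, ← iSup_weightSpace P]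
  exact iSup_le fun α => (h α).trans (le_iSup W (i α))

theorem conjDiag_comp_mem_lieAlg [CharZero K] {G : Subgroup (GL (Fin n) K)} {P : GL (Fin n) K}
    {d : Fin n → K} {N : Matrix (Fin n) (Fin n) K} (hN : IsNilpotent N)
    (hc : Commute (conjDiag P d) N) (h : conjDiag P d + N ∈ lieAlg G) (f : K →ₗ[ℚ] K) :
    conjDiag P (f ∘ d) ∈ lieAlg G := by
  rw [mem_lieAlg] at *
  refine stable_of_iSup_inf_eigenspace f ?_ h
  refine iSup_eq_top_of_weightSpace_le (P := P) (fun α => ∑ i, (α i : K) * d i) fun α p hp =>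
    ⟨weightSpace_le_maxGenEigenspace hN hc α hp, ?_⟩
  refine Module.End.mem_eigenspace_iff.2 ?_
  have hf : f (∑ i, (α i : K) * d i) = ∑ i, (α i : K) * f (d i) := by
    rw [map_sum]
    refine Finset.sum_congr rfl fun i _ => ?_
    rw [← zsmul_eq_mul, map_zsmul, zsmul_eq_mul]
  rw [hf]
  exact leftDer_conjDiag_of_mem hp _

theorem conjDiag_mem_lieAlg [CharZero K] {G : Subgroup (GL (Fin n) K)} {P : GL (Fin n) K}
    {d : Fin n → K} {N : Matrix (Fin n) (Fin n) K} (hN : IsNilpotent N)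
    (hc : Commute (conjDiag P d) N) (h : conjDiag P d + N ∈ lieAlg G) :
    conjDiag P d ∈ lieAlg G :=
  conjDiag_comp_mem_lieAlg hN hc h LinearMap.id

theorem conj_diagGL_zpow_mem [CharZero K] {G : Subgroup (GL (Fin n) K)}
    (hG : IsZClosed (G : Set (GL (Fin n) K))) {P : GL (Fin n) K}
    {d : Fin n → K} {N : Matrix (Fin n) (Fin n) K} (hN : IsNilpotent N)
    (hc : Commute (conjDiag P d) N) (h : conjDiag P d + N ∈ lieAlg G) (f : K →ₗ[ℚ] ℚ)
    {z : Fin n → ℤ} (hz : ∀ i, f (d i) = z i) (c : Kˣ) :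
    P * diagGL (fun i => c ^ z i) * P⁻¹ ∈ G := by
  refine mem_of_rightTrans_mem_vanishing hG ?_
  refine stable_of_iSup_inf_eigenspace (fun ν => ((c ^ (f ν).num : Kˣ) : K)) ?_ (mem_lieAlg.1 h)
  refine iSup_eq_top_of_weightSpace_le (P := P) (fun α => ∑ i, (α i : K) * d i) fun α p hp =>
    ⟨weightSpace_le_maxGenEigenspace hN hc α hp, ?_⟩
  refine Module.End.mem_eigenspace_iff.2 ?_
  have hf : f (∑ i, (α i : K) * d i) = ((∑ i, α i * z i : ℤ) : ℚ) := by
    rw [map_sum, Int.cast_sum]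
    refine Finset.sum_congr rfl fun i _ => ?_
    rw [← zsmul_eq_mul, map_zsmul, zsmul_eq_mul, hz, Int.cast_mul]
  rw [hf, Rat.num_intCast]
  have := (mem_weightSpace.1 hp).2 (fun i => c ^ z i)
  rw [AlgHom.toLinearMap_apply, this]
  congr 2
  have hpow : ∀ s : Finset (Fin n), ∏ i ∈ s, (c ^ z i) ^ α i = c ^ ∑ i ∈ s, α i * z i := by
    intro s
    induction s using Finset.induction_on with
    | empty => simp
    | insert i s hi ih =>
      rw [Finset.prod_insert hi, Finset.sum_insert hi, ih, ← _root_.zpow_mul, mul_comm (z i),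
        _root_.zpow_add]
  exact hpow _

theorem rightTrans_commute {g h : GL (Fin n) K} (hc : Commute g h) :
    Commute (rightTrans g).toLinearMap (rightTrans h).toLinearMap := by
  rw [commute_iff_eq]
  change ((rightTrans g).comp (rightTrans h)).toLinearMap =
    ((rightTrans h).comp (rightTrans g)).toLinearMap
  rw [← rightTrans_mul, ← rightTrans_mul, hc.eq]

theorem weightSpace_le_eigenspace {P : GL (Fin n) K} (c : Fin n → Kˣ) (α : Fin n → ℤ) :
    weightSpace P α ≤ Module.End.eigenspace (rightTrans (P * diagGL c * P⁻¹)).toLinearMap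
      ((∏ i, c i ^ α i : Kˣ) : K) := fun _ hp =>
  Module.End.mem_eigenspace_iff.2 ((mem_weightSpace.1 hp).2 c)

theorem conj_diagGL_mem_of_mul_mem {G : Subgroup (GL (Fin n) K)}
    (hG : IsZClosed (G : Set (GL (Fin n) K))) {P : GL (Fin n) K}
    {c : Fin n → Kˣ} {u : GL (Fin n) K} (hu : IsNilpotent ((u : Matrix (Fin n) (Fin n) K) - 1))
    (hc : Commute (P * diagGL c * P⁻¹) u) (h : P * diagGL c * P⁻¹ * u ∈ G) :
    P * diagGL c * P⁻¹ ∈ G := by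
  set s := P * diagGL c * P⁻¹ with hs
  refine mem_of_rightTrans_mem_vanishing hG ?_
  refine stable_of_iSup_inf_eigenspace id ?_ (rightTrans_mem_vanishing h)
  refine iSup_eq_top_of_weightSpace_le (P := P)
    (fun α => ((∏ i, c i ^ α i : Kˣ) : K)) fun α p hp => ⟨?_, weightSpace_le_eigenspace c α hp⟩
  have hcom := rightTrans_commute hc
  refine mem_maxGenEigenspace_of_commute (E := (rightTrans s).toLinearMap)
    (Δ := (rightTrans s).toLinearMap * ((rightTrans u).toLinearMap - 1)) ?_ ?_
    ((mem_weightSpace.1 hp).2 c) ?_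
  · rw [rightTrans_mul, mul_sub, mul_one, add_sub_cancel]
    rfl
  · exact (Commute.refl _).mul_right (hcom.sub_right (Commute.one_right _))
  · obtain ⟨k, hk⟩ := exists_rightTrans_sub_one_pow_eq_zero hu p
    refine ⟨k, ?_⟩
    rw [(hcom.sub_right (Commute.one_right _)).mul_pow, Module.End.mul_apply, hk, map_zero]

end Jordan

section Diagonalization

variable {n : ℕ}

theorem mul_eq_mul_diagonal_iff {A Q : Matrix (Fin n) (Fin n) K} {d : Fin n → K} :
    A * Q = Q * Matrix.diagonal d ↔ ∀ j, A *ᵥ (fun i => Q i j) = d j • fun i => Q i j := by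
  rw [← Matrix.ext_iff, forall_comm]
  refine forall_congr' fun j => ?_
  rw [funext_iff]
  refine forall_congr' fun i => ?_
  rw [Matrix.mul_diagonal, Pi.smul_apply, smul_eq_mul, mul_comm (d j)]
  rfl

theorem eq_conjDiag_iff {A : Matrix (Fin n) (Fin n) K} {P : GL (Fin n) K} {d : Fin n → K} :
    A = conjDiag P d ↔ A * (P : Matrix (Fin n) (Fin n) K) = P * Matrix.diagonal d :=
  Units.eq_mul_inv_iff_mul_eq P

theorem exists_conjDiag_of_span {s : Set (Matrix (Fin n) (Fin n) K)}
    (hs : Submodule.span K {v : Fin n → K | ∀ A ∈ s, ∃ μ : K, A *ᵥ v = μ • v} = ⊤) :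
    ∃ P : GL (Fin n) K, ∀ A ∈ s, ∃ d, A = conjDiag P d := by
  have hsub := Module.Basis.ofSpan_subset hs.ge
  set b := Module.Basis.ofSpan hs.ge
  have := Module.Finite.finite_basis b
  have := Fintype.ofFinite ((linearIndepOn_empty K id).extend
    (Set.empty_subset {v : Fin n → K | ∀ A ∈ s, ∃ μ : K, A *ᵥ v = μ • v}))
  have hcard := Module.finrank_eq_card_basis b
  rw [Module.finrank_fin_fun] at hcard
  set b' := b.reindex (Fintype.equivFinOfCardEq hcard.symm) with hb'
  have hb : ∀ j, b' j ∈ {v : Fin n → K | ∀ A ∈ s, ∃ μ : K, A *ᵥ v = μ • v} := by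
    intro j
    rw [hb', Module.Basis.reindex_apply]
    exact hsub (Set.mem_range_self _)
  have hinv := (Pi.basisFun K (Fin n)).invertibleToMatrix b'
  refine ⟨unitOfInvertible ((Pi.basisFun K (Fin n)).toMatrix b'), fun A hA => ?_⟩
  choose d hd using fun j => hb j A hA
  refine ⟨d, eq_conjDiag_iff.2 (mul_eq_mul_diagonal_iff.2 fun j => ?_)⟩
  exact hd j

theorem conjDiag_mulVec (P : GL (Fin n) K) (d v : Fin n → K) :
    conjDiag P d *ᵥ ((P : Matrix (Fin n) (Fin n) K) *ᵥ v) =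
      (P : Matrix (Fin n) (Fin n) K) *ᵥ fun i => d i * v i := by
  rw [conjDiag, Matrix.mulVec_mulVec, mul_assoc, Units.inv_mul, mul_one, ← Matrix.mulVec_mulVec]
  congr 1
  ext i
  rw [Matrix.mulVec_diagonal]

theorem exists_eq_mulVec (P : GL (Fin n) K) (v : Fin n → K) :
    ∃ w, v = (P : Matrix (Fin n) (Fin n) K) *ᵥ w :=
  ⟨((P⁻¹ : GL (Fin n) K) : Matrix (Fin n) (Fin n) K) *ᵥ v, by
    rw [Matrix.mulVec_mulVec, Units.mul_inv, Matrix.one_mulVec]⟩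

theorem iSup_eigenspace_conjDiag (P : GL (Fin n) K) (d : Fin n → K) :
    ⨆ μ, Module.End.eigenspace (Matrix.toLin' (conjDiag P d)) μ = ⊤ := by
  rw [eq_top_iff]
  intro v _
  obtain ⟨w, rfl⟩ := exists_eq_mulVec P v
  have : w = ∑ i, Pi.single i (w i) := (Finset.univ_sum_single w).symm
  rw [this, Matrix.mulVec_sum]
  refine sum_mem fun i _ => Submodule.mem_iSup_of_mem (d i) ?_
  rw [Module.End.mem_eigenspace_iff, Matrix.toLin'_apply, conjDiag_mulVec, ← Matrix.mulVec_smul]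
  congr 1
  ext j
  by_cases h : j = i
  · subst h; simp
  · simp [h]

theorem maxGenEigenspace_conjDiag (P : GL (Fin n) K) (d : Fin n → K) (μ : K) :
    Module.End.maxGenEigenspace (Matrix.toLin' (conjDiag P d)) μ =
      Module.End.eigenspace (Matrix.toLin' (conjDiag P d)) μ :=
  maxGenEigenspace_eq_eigenspace_of_iSup_eq_top (iSup_eigenspace_conjDiag P d) μ

theorem exists_conjDiag_of_commute {s : Set (Matrix (Fin n) (Fin n) K)}
    (hd : ∀ A ∈ s, ∃ P d, A = conjDiag P d) (hc : ∀ A ∈ s, ∀ B ∈ s, Commute A B) :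
    ∃ P : GL (Fin n) K, ∀ A ∈ s, ∃ d, A = conjDiag P d := by
  refine exists_conjDiag_of_span ?_
  have h := Module.End.iSup_iInf_maxGenEigenspace_eq_top_of_iSup_maxGenEigenspace_eq_top_of_commute
    (fun A : s => Matrix.toLin' (A : Matrix (Fin n) (Fin n) K)) (fun A B _ => by
      change Commute (Matrix.toLin' (A : Matrix (Fin n) (Fin n) K)) (Matrix.toLin' B)
      rw [commute_iff_eq, Module.End.mul_eq_comp, Module.End.mul_eq_comp, ← Matrix.toLin'_mul,
        ← Matrix.toLin'_mul, (hc A A.2 B B.2).eq]) (fun A => by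
      obtain ⟨P, d, h⟩ := hd A A.2
      rw [h, ← iSup_eigenspace_conjDiag P d]
      exact iSup_congr fun μ => maxGenEigenspace_conjDiag P d μ)
  rw [eq_top_iff, ← h]
  refine iSup_le fun χ v hv => Submodule.subset_span fun A hA => ⟨χ ⟨A, hA⟩, ?_⟩
  have hv' := (Submodule.mem_iInf _).1 hv ⟨A, hA⟩
  obtain ⟨P, d, h⟩ := hd A hA
  change v ∈ Module.End.maxGenEigenspace (Matrix.toLin' A) (χ ⟨A, hA⟩) at hv'
  generalize χ ⟨A, hA⟩ = μ at hv' ⊢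
  rw [h, maxGenEigenspace_conjDiag, Module.End.mem_eigenspace_iff, Matrix.toLin'_apply] at hv'
  rw [h, hv']

theorem exists_jordan [IsAlgClosed K] (A : Matrix (Fin n) (Fin n) K) :
    ∃ (P : GL (Fin n) K) (d : Fin n → K) (N : Matrix (Fin n) (Fin n) K), IsNilpotent N ∧
      A = conjDiag P d + N ∧ ∀ B, Commute A B → Commute (conjDiag P d) B ∧ Commute N B := by
  obtain ⟨N, hN, S, hS, hnil, hss, h⟩ :=
    Module.End.exists_isNilpotent_isSemisimple (f := Matrix.toLinAlgEquiv' A)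
  have hdiag : ∃ P : GL (Fin n) K, ∀ A ∈ ({LinearMap.toMatrixAlgEquiv' S} : Set _),
      ∃ d, A = conjDiag P d := by
    refine exists_conjDiag_of_span ?_
    rw [eq_top_iff, ← Module.End.iSup_maxGenEigenspace_eq_top S]
    refine iSup_le fun μ v hv => Submodule.subset_span ?_
    rintro _ rfl
    rw [hss.isFinitelySemisimple.maxGenEigenspace_eq_eigenspace,
      Module.End.mem_eigenspace_iff] at hv
    refine ⟨μ, ?_⟩
    rw [← hv, ← Matrix.toLinAlgEquiv'_apply, Matrix.toLinAlgEquiv'_toMatrixAlgEquiv']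
  obtain ⟨P, hP⟩ := hdiag
  obtain ⟨d, hd⟩ := hP _ rfl
  have key : ∀ T ∈ Algebra.adjoin K {Matrix.toLinAlgEquiv' A}, ∀ B, Commute A B →
      Commute (LinearMap.toMatrixAlgEquiv' T) B := by
    intro T hT B hB
    have h1 : Commute T (Matrix.toLinAlgEquiv' B) :=
      (Algebra.commute_of_mem_adjoin_singleton_of_commute hT
        ((hB.map (Matrix.toLinAlgEquiv' (R := K) (n := Fin n))).symm)).symm
    simpa using h1.map (LinearMap.toMatrixAlgEquiv' (R := K) (n := Fin n))
  refine ⟨P, d, LinearMap.toMatrixAlgEquiv' N, hnil.map _, ?_, fun B hB => ⟨?_, key N hN B hB⟩⟩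
  · have := congrArg (LinearMap.toMatrixAlgEquiv' (R := K) (n := Fin n)) h
    rw [LinearMap.toMatrixAlgEquiv'_toLinAlgEquiv', map_add, hd] at this
    rw [this, add_comm]
  · rw [← hd]
    exact key S hS B hB

end Diagonalization

section Curves

open Polynomial in
theorem polynomial_eq_of_natCast_eval_eq [CharZero K] {p q : Polynomial K}
    (h : ∀ k : ℕ, p.eval (k : K) = q.eval (k : K)) : p = q :=
  Polynomial.eq_of_infinite_eval_eq p q
    (Set.infinite_of_injective_forall_mem Nat.cast_injective h)

variable {n : ℕ} {R : Type*} [CommRing R] [Algebra K R]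

/-- Evaluation of polynomials in the entries of a matrix and of its inverse. -/
noncomputable def matSubst (M M' : Matrix (Fin n) (Fin n) R) : CoordPoly K n →ₐ[K] R :=
  aeval (Sum.elim (fun q => M q.1 q.2) (fun q => M' q.1 q.2))

@[simp] theorem matSubst_inl (M M' : Matrix (Fin n) (Fin n) R) (i j : Fin n) :
    matSubst M M' (X (Sum.inl (i, j)) : CoordPoly K n) = M i j := by
  simp [matSubst]

@[simp] theorem matSubst_inr (M M' : Matrix (Fin n) (Fin n) R) (i j : Fin n) :
    matSubst M M' (X (Sum.inr (i, j)) : CoordPoly K n) = M' i j := by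
  simp [matSubst]

/-- Evaluation of a polynomial matrix at a point. -/
noncomputable def evalGL (t : K) : GL (Fin n) (Polynomial K) →* GL (Fin n) K :=
  Matrix.GeneralLinearGroup.map (Polynomial.evalRingHom t)

theorem evalGL_apply (t : K) (γ : GL (Fin n) (Polynomial K)) (i j : Fin n) :
    (evalGL t γ : Matrix (Fin n) (Fin n) K) i j =
      ((γ : Matrix (Fin n) (Fin n) (Polynomial K)) i j).eval t := rfl

theorem evalGL_inv_apply (t : K) (γ : GL (Fin n) (Polynomial K)) (i j : Fin n) :
    (((evalGL t γ)⁻¹ : GL (Fin n) K) : Matrix (Fin n) (Fin n) K) i j =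
      (((γ⁻¹ : GL (Fin n) (Polynomial K)) : Matrix (Fin n) (Fin n) (Polynomial K)) i j).eval t := by
  rw [← map_inv]
  rfl

theorem eval_matSubst (t : K) (γ : GL (Fin n) (Polynomial K)) (p : CoordPoly K n) :
    (matSubst (γ : Matrix (Fin n) (Fin n) (Polynomial K))
      ((γ⁻¹ : GL (Fin n) (Polynomial K)) : Matrix (Fin n) (Fin n) (Polynomial K)) p).eval t =
      eval (matOf (evalGL t γ)) p := by
  induction p using MvPolynomial.induction_on with
  | C r => simp [← algebraMap_eq]
  | add p q hp hq => simp only [map_add, Polynomial.eval_add, hp, hq]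
  | mul_X p v hp =>
    rw [map_mul, map_mul, Polynomial.eval_mul, hp]
    congr 1
    rcases v with ⟨i, j⟩ | ⟨i, j⟩
    · rw [matSubst_inl, eval_X]
      rfl
    · rw [matSubst_inr, eval_X, ← evalGL_inv_apply]
      rfl

/-- The constant curve. -/
noncomputable def constGL : GL (Fin n) K →* GL (Fin n) (Polynomial K) :=
  Matrix.GeneralLinearGroup.map Polynomial.C

@[simp] theorem evalGL_constGL (t : K) (g : GL (Fin n) K) : evalGL t (constGL g) = g := by
  ext i j
  simp [evalGL_apply, constGL]

/-- The velocity at the origin of a polynomial curve. -/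
noncomputable def velocity (γ : GL (Fin n) (Polynomial K)) : Matrix (Fin n) (Fin n) K :=
  (γ : Matrix (Fin n) (Fin n) (Polynomial K)).map fun p => p.derivative.eval 0

theorem velocity_mul (γ δ : GL (Fin n) (Polynomial K)) :
    velocity (γ * δ) = velocity γ * (evalGL 0 δ : Matrix (Fin n) (Fin n) K) +
      (evalGL 0 γ : Matrix (Fin n) (Fin n) K) * velocity δ := by
  ext i j
  simp [velocity, Matrix.mul_apply, evalGL_apply, Polynomial.eval_finsetSum,
    Finset.sum_add_distrib]

theorem velocity_constGL (g : GL (Fin n) K) : velocity (constGL g) = 0 := by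
  ext i j
  simp [velocity, constGL]

theorem velocity_inv {γ : GL (Fin n) (Polynomial K)} (h : evalGL 0 γ = 1) :
    velocity γ⁻¹ = -velocity γ := by
  have h1 := velocity_mul γ γ⁻¹
  rw [mul_inv_cancel, map_inv, h] at h1
  have h2 : velocity (1 : GL (Fin n) (Polynomial K)) = 0 := by
    rw [← map_one constGL, velocity_constGL]
  rw [h2] at h1
  simp only [inv_one, Units.val_one, mul_one, one_mul] at h1
  exact (neg_eq_of_add_eq_zero_right h1.symm).symm

theorem eval_derivative_matSubst {γ : GL (Fin n) (Polynomial K)} (h : evalGL 0 γ = 1)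
    (g : GL (Fin n) K) (p : CoordPoly K n) :
    (matSubst ((constGL g * γ : GL (Fin n) (Polynomial K)) :
        Matrix (Fin n) (Fin n) (Polynomial K))
      (((constGL g * γ)⁻¹ : GL (Fin n) (Polynomial K)) :
        Matrix (Fin n) (Fin n) (Polynomial K)) p).derivative.eval 0 =
      eval (matOf g) (leftDer (velocity γ) p) := by
  have hg : evalGL 0 (constGL g * γ) = g := by rw [map_mul, h, evalGL_constGL, mul_one]
  induction p using MvPolynomial.induction_on with
  | C r => simp [← algebraMap_eq]
  | add p q hp hq => simp only [map_add, Polynomial.eval_add, hp, hq]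
  | mul_X p v hp =>
    rw [map_mul, Polynomial.derivative_mul, Polynomial.eval_add, Polynomial.eval_mul,
      Polynomial.eval_mul, hp, eval_matSubst, eval_matSubst, hg, Derivation.leibniz, map_add,
      smul_eq_mul, smul_eq_mul, map_mul, map_mul, add_comm, mul_comm (eval _ (X v))]
    congr 2
    rcases v with ⟨i, j⟩ | ⟨i, j⟩
    · have h1 := congrFun (congrFun (velocity_mul (constGL g) γ) i) j
      rw [velocity_constGL, zero_mul, zero_add, evalGL_constGL] at h1
      rw [matSubst_inl, leftDer_X_inl, Matrix.mul_apply, map_sum]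
      refine h1.trans ?_
      simp [Matrix.mul_apply, genMat, matOf]
    · have h1 := congrFun (congrFun (velocity_mul γ⁻¹ (constGL g)⁻¹) i) j
      rw [← map_inv constGL, velocity_constGL, mul_zero, add_zero, evalGL_constGL, map_inv,
        velocity_inv h] at h1
      rw [matSubst_inr, leftDer_X_inr, Matrix.mul_apply, map_neg, map_sum, _root_.mul_inv_rev]
      refine h1.trans ?_
      simp [Matrix.mul_apply, genInv, matOf, -Matrix.coe_units_inv]

theorem velocity_mem_lieAlg [CharZero K] {G : Subgroup (GL (Fin n) K)}
    {γ : GL (Fin n) (Polynomial K)} (h0 : evalGL 0 γ = 1) (h : ∀ k : ℕ, evalGL (k : K) γ ∈ G) :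
    velocity γ ∈ lieAlg G := by
  rw [mem_lieAlg]
  intro p hp g hg
  change eval (matOf g) (leftDer (velocity γ) p) = 0
  rw [← eval_derivative_matSubst h0]
  have : matSubst ((constGL g * γ : GL (Fin n) (Polynomial K)) :
        Matrix (Fin n) (Fin n) (Polynomial K))
      (((constGL g * γ)⁻¹ : GL (Fin n) (Polynomial K)) :
        Matrix (Fin n) (Fin n) (Polynomial K)) p = 0 := by
    refine polynomial_eq_of_natCast_eval_eq fun k => ?_
    rw [eval_matSubst, map_mul, evalGL_constGL, Polynomial.eval_zero]
    exact hp _ (G.mul_mem hg (h k))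
  rw [this]
  simp

theorem evalGL_mem_of_natCast [CharZero K] {G : Subgroup (GL (Fin n) K)}
    (hG : IsZClosed (G : Set (GL (Fin n) K)))
    {γ : GL (Fin n) (Polynomial K)} (h : ∀ k : ℕ, evalGL (k : K) γ ∈ G) (t : K) :
    evalGL t γ ∈ G := by
  refine hG.mem_of_vanishing fun p hp => ?_
  rw [← eval_matSubst]
  have : matSubst (γ : Matrix (Fin n) (Fin n) (Polynomial K))
      ((γ⁻¹ : GL (Fin n) (Polynomial K)) : Matrix (Fin n) (Fin n) (Polynomial K)) p = 0 := by
    refine polynomial_eq_of_natCast_eval_eq fun k => ?_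
    rw [eval_matSubst, Polynomial.eval_zero]
    exact hp _ (h k)
  rw [this, Polynomial.eval_zero]

end Curves

section OneParameter

variable {n : ℕ}

theorem pow_eq_zero_of_isNilpotent {N : Matrix (Fin n) (Fin n) K} (h : IsNilpotent N) :
    N ^ n = 0 := by
  have h1 := (Matrix.isNilpotent_charpoly_sub_pow_of_isNilpotent h).eq_zero
  rw [Fintype.card_fin, sub_eq_zero] at h1
  have h2 := Matrix.aeval_self_charpoly N
  rwa [h1, map_pow, Polynomial.aeval_X] at h2

theorem isUnipotentElt_of_isNilpotent {u : GL (Fin n) K}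
    (h : IsNilpotent ((u : Matrix (Fin n) (Fin n) K) - 1)) : IsUnipotentElt u :=
  pow_eq_zero_of_isNilpotent h

/-- The polynomial matrix interpolating the powers of `1 + M`, for `M` nilpotent. -/
noncomputable def binomCurve (M : Matrix (Fin n) (Fin n) K) :
    Matrix (Fin n) (Fin n) (Polynomial K) :=
  ∑ j ∈ Finset.range n, (Polynomial.C ((j.factorial : K)⁻¹) * descPochhammer K j) •
    (M ^ j).map Polynomial.C

theorem binomCurve_eval_natCast [CharZero K] {M : Matrix (Fin n) (Fin n) K} (hM : IsNilpotent M)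
    (k : ℕ) : (binomCurve M).map (Polynomial.eval (k : K)) = (1 + M) ^ k := by
  have h1 : (binomCurve M).map (Polynomial.eval (k : K)) =
      ∑ j ∈ Finset.range n, (k.choose j : K) • M ^ j := by
    ext i l
    simp only [binomCurve, Matrix.map_apply, Matrix.sum_apply, Polynomial.eval_finsetSum,
      Matrix.smul_apply, smul_eq_mul, Polynomial.eval_mul, Polynomial.eval_C,
      descPochhammer_eval_eq_descFactorial]
    refine Finset.sum_congr rfl fun j _ => ?_
    rw [Nat.descFactorial_eq_factorial_mul_choose, Nat.cast_mul, inv_mul_cancel_left₀]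
    exact Nat.cast_ne_zero.2 j.factorial_ne_zero
  rw [h1, add_comm, (Commute.one_right M).add_pow]
  simp only [one_pow, mul_one]
  have h2 : ∀ m, k + 1 ≤ m → ∑ j ∈ Finset.range (k + 1), M ^ j * (k.choose j : Matrix (Fin n) (Fin n) K) =
      ∑ j ∈ Finset.range m, (k.choose j : K) • M ^ j := by
    intro m hm
    rw [← Finset.sum_subset (Finset.range_mono hm)]
    · refine Finset.sum_congr rfl fun j _ => ?_
      rw [Nat.cast_smul_eq_nsmul, nsmul_eq_mul, (Nat.cast_commute _ _).eq]
    · intro j _ hj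
      rw [Nat.choose_eq_zero_of_lt (by simpa using hj), Nat.cast_zero, zero_smul]
  rw [h2 (max (k + 1) n) (le_max_left _ _)]
  refine Finset.sum_subset (Finset.range_mono (le_max_right _ _)) fun j _ hj => ?_
  rw [pow_eq_zero_of_le (by simpa using hj) (pow_eq_zero_of_isNilpotent hM), smul_zero]

theorem exists_evalGL_eq_pow [CharZero K] {u : GL (Fin n) K}
    (hu : IsNilpotent ((u : Matrix (Fin n) (Fin n) K) - 1)) :
    ∃ γ : GL (Fin n) (Polynomial K), ∀ k : ℕ, evalGL (k : K) γ = u ^ k := by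
  have key : ∀ u : GL (Fin n) K, IsNilpotent ((u : Matrix (Fin n) (Fin n) K) - 1) → ∀ k : ℕ,
      (binomCurve ((u : Matrix (Fin n) (Fin n) K) - 1)).map (Polynomial.evalRingHom (k : K)) =
        ((u ^ k : GL (Fin n) K) : Matrix (Fin n) (Fin n) K) := by
    intro u hu k
    rw [Units.val_pow_eq_pow_val]
    exact (binomCurve_eval_natCast hu k).trans (by rw [add_sub_cancel])
  have key2 : ∀ u v : GL (Fin n) K, IsNilpotent ((u : Matrix (Fin n) (Fin n) K) - 1) →
      IsNilpotent ((v : Matrix (Fin n) (Fin n) K) - 1) → v * u = 1 →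
      binomCurve ((u : Matrix (Fin n) (Fin n) K) - 1) *
        binomCurve ((v : Matrix (Fin n) (Fin n) K) - 1) = 1 := by
    intro u v hu hv huv
    ext1 i j
    refine polynomial_eq_of_natCast_eval_eq fun k => ?_
    have hv' : v = u⁻¹ := eq_inv_of_mul_eq_one_left huv
    have h : (binomCurve ((u : Matrix (Fin n) (Fin n) K) - 1) *
        binomCurve ((v : Matrix (Fin n) (Fin n) K) - 1)).map (Polynomial.evalRingHom (k : K)) =
        1 := by
      rw [Matrix.map_mul, key u hu, key v hv, ← Units.val_mul, hv', inv_pow, mul_inv_cancel,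
        Units.val_one]
    refine (congrFun (congrFun h i) j).trans ?_
    rw [Matrix.one_apply, Matrix.one_apply]
    split_ifs <;> simp
  exact ⟨⟨binomCurve _, binomCurve _, key2 u u⁻¹ hu (isNilpotent_inv_sub_one hu) (inv_mul_cancel u),
    key2 u⁻¹ u (isNilpotent_inv_sub_one hu) hu (mul_inv_cancel u)⟩,
    fun k => Units.ext (key u hu k)⟩

/-- The exponential `exp (X • N)` of a nilpotent matrix. -/
noncomputable def expCurve (N : Matrix (Fin n) (Fin n) K) :
    Matrix (Fin n) (Fin n) (Polynomial K) :=
  ∑ j ∈ Finset.range (n + 1), (Polynomial.C ((j.factorial : K)⁻¹) * Polynomial.X ^ j) •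
    (N ^ j).map Polynomial.C

theorem derivative_expCurve [CharZero K] {N : Matrix (Fin n) (Fin n) K} (hN : IsNilpotent N) :
    (expCurve N).map Polynomial.derivative = expCurve N * N.map Polynomial.C := by
  have h1 : (expCurve N).map Polynomial.derivative =
      ∑ j ∈ Finset.range n, (Polynomial.C ((j.factorial : K)⁻¹) * Polynomial.X ^ j) •
        (N ^ (j + 1)).map Polynomial.C := by
    ext1 i l
    simp only [expCurve, Matrix.map_apply, Matrix.sum_apply, Polynomial.derivative_sum,
      Matrix.smul_apply, smul_eq_mul]
    rw [Finset.sum_range_succ']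
    simp only [Polynomial.derivative_mul, Polynomial.derivative_C, mul_zero, add_zero, zero_mul,
      zero_add, pow_zero, Polynomial.derivative_one, Polynomial.derivative_X_pow]
    refine Finset.sum_congr rfl fun j _ => ?_
    rw [← mul_assoc, ← Polynomial.C_mul, Nat.add_sub_cancel]
    congr 3
    rw [Nat.factorial_succ, Nat.cast_mul, mul_inv, mul_right_comm, inv_mul_cancel₀, one_mul]
    exact Nat.cast_ne_zero.2 j.succ_ne_zero
  rw [h1, expCurve, Finset.sum_range_succ, pow_eq_zero_of_isNilpotent hN]
  simp [Finset.sum_mul, pow_succ, Matrix.map_mul]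

theorem expCurve_mul_comm (N : Matrix (Fin n) (Fin n) K) :
    N.map Polynomial.C * expCurve N = expCurve N * N.map Polynomial.C := by
  simp only [expCurve, Finset.sum_mul, Finset.mul_sum, smul_mul_assoc, mul_smul_comm,
    ← Matrix.map_mul, ← pow_succ, ← pow_succ']

theorem derivative_matSubst_expCurve [CharZero K] {N : Matrix (Fin n) (Fin n) K}
    (hN : IsNilpotent N) (p : CoordPoly K n) :
    (matSubst (expCurve N) (expCurve (-N)) p).derivative =
      matSubst (expCurve N) (expCurve (-N)) (leftDer N p) := by
  induction p using MvPolynomial.induction_on with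
  | C r => simp [← algebraMap_eq]
  | add p q hp hq => simp only [map_add, hp, hq]
  | mul_X p v hp =>
    rw [map_mul, Polynomial.derivative_mul, hp, Derivation.leibniz, map_add,
      smul_eq_mul, smul_eq_mul, map_mul, map_mul, add_comm, mul_comm _ (matSubst _ _ (X v))]
    congr 2
    rcases v with ⟨i, j⟩ | ⟨i, j⟩
    · rw [matSubst_inl, leftDer_X_inl, Matrix.mul_apply, map_sum]
      refine (congrFun (congrFun (derivative_expCurve hN) i) j).trans ?_
      simp [Matrix.mul_apply, genMat, ← algebraMap_eq]
    · rw [matSubst_inr, leftDer_X_inr, Matrix.mul_apply, map_neg, map_sum]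
      refine (congrFun (congrFun (derivative_expCurve hN.neg) i) j).trans ?_
      rw [← expCurve_mul_comm]
      simp [Matrix.mul_apply, genInv, ← algebraMap_eq]

theorem eval_matSubst_of_map_eval {M M' : Matrix (Fin n) (Fin n) (Polynomial K)} {t : K}
    {g : GL (Fin n) K} (hM : M.map (Polynomial.eval t) = g)
    (hM' : M'.map (Polynomial.eval t) = ((g⁻¹ : GL (Fin n) K) : Matrix (Fin n) (Fin n) K))
    (p : CoordPoly K n) : (matSubst M M' p).eval t = eval (matOf g) p := by
  induction p using MvPolynomial.induction_on with
  | C r => simp [← algebraMap_eq]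
  | add p q hp hq => simp only [map_add, Polynomial.eval_add, hp, hq]
  | mul_X p v hp =>
    rw [map_mul, map_mul, Polynomial.eval_mul, hp]
    congr 1
    rcases v with ⟨i, j⟩ | ⟨i, j⟩
    · rw [matSubst_inl, eval_X]
      exact congrFun (congrFun hM i) j
    · rw [matSubst_inr, eval_X]
      exact congrFun (congrFun hM' i) j

theorem expCurve_map_eval (N : Matrix (Fin n) (Fin n) K) (t : K) :
    (expCurve N).map (Polynomial.eval t) =
      ∑ j ∈ Finset.range (n + 1), ((j.factorial : K)⁻¹ * t ^ j) • N ^ j := by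
  ext i l
  simp [expCurve, Matrix.sum_apply, Polynomial.eval_finsetSum]
  exact Finset.sum_congr rfl fun _ _ => by ring

theorem expCurve_map_eval_zero (N : Matrix (Fin n) (Fin n) K) :
    (expCurve N).map (Polynomial.eval 0) = 1 := by
  rw [expCurve_map_eval, Finset.sum_range_succ']
  simp

theorem matSubst_expCurve_eq_zero [CharZero K] {G : Subgroup (GL (Fin n) K)}
    {N : Matrix (Fin n) (Fin n) K} (hN : IsNilpotent N) (hG : N ∈ lieAlg G) {p : CoordPoly K n}
    (hp : p ∈ vanishing (G : Set (GL (Fin n) K))) :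
    matSubst (expCurve N) (expCurve (-N)) p = 0 := by
  have h0 : ∀ p ∈ vanishing (G : Set (GL (Fin n) K)),
      (matSubst (expCurve N) (expCurve (-N)) p).eval 0 = 0 := fun p hp => by
    rw [eval_matSubst_of_map_eval (g := 1) (by simpa using expCurve_map_eval_zero N)
      (by simpa using expCurve_map_eval_zero (-N))]
    exact hp 1 G.one_mem
  have hk : ∀ k, ∀ p ∈ vanishing (G : Set (GL (Fin n) K)),
      (Polynomial.derivative^[k] (matSubst (expCurve N) (expCurve (-N)) p)).eval 0 = 0 := by
    intro k
    induction k with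
    | zero => exact h0
    | succ k ih =>
      intro p hp
      rw [Function.iterate_succ_apply, derivative_matSubst_expCurve hN]
      exact ih _ (mem_lieAlg.1 hG p hp)
  ext k
  have := hk k p hp
  rw [← Polynomial.coeff_zero_eq_eval_zero, Polynomial.coeff_iterate_derivative, zero_add,
    nsmul_eq_mul, Nat.descFactorial_self] at this
  simpa [Nat.factorial_ne_zero] using this

theorem genMat_mul_genInv_sub_one_mem_vanishing (s : Set (GL (Fin n) K)) (i j : Fin n) :
    (genMat K n * genInv K n - 1) i j ∈ vanishing s := by
  intro A _
  have h := congrFun (congrFun (Units.mul_inv A) i) j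
  rw [Matrix.sub_apply, map_sub, Matrix.mul_apply, map_sum, sub_eq_zero]
  rw [Matrix.mul_apply] at h
  have h1 : eval (matOf A) ((1 : Matrix (Fin n) (Fin n) (CoordPoly K n)) i j) =
      (1 : Matrix (Fin n) (Fin n) K) i j := by
    rw [Matrix.one_apply, Matrix.one_apply]
    split_ifs <;> simp
  rw [h1]
  refine Eq.trans ?_ h
  simp [genMat, genInv, matOf]

theorem expCurve_mul_expCurve_neg [CharZero K] {G : Subgroup (GL (Fin n) K)}
    {N : Matrix (Fin n) (Fin n) K} (hN : IsNilpotent N) (hG : N ∈ lieAlg G) :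
    expCurve N * expCurve (-N) = 1 := by
  ext1 i j
  have h := matSubst_expCurve_eq_zero hN hG (genMat_mul_genInv_sub_one_mem_vanishing _ i j)
  rw [Matrix.sub_apply, map_sub, sub_eq_zero, Matrix.mul_apply, map_sum] at h
  rw [Matrix.mul_apply]
  refine Eq.trans ?_ (h.trans ?_)
  · simp [genMat, genInv]
  · rw [Matrix.one_apply, Matrix.one_apply]
    split_ifs <;> simp

theorem exists_exponential_curve [CharZero K] {G : Subgroup (GL (Fin n) K)}
    (hcl : IsZClosed (G : Set (GL (Fin n) K)))
    {N : Matrix (Fin n) (Fin n) K} (hN : IsNilpotent N) (hG : N ∈ lieAlg G) :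
    ∃ γ : GL (Fin n) (Polynomial K), velocity γ = N ∧ ∀ t, evalGL t γ ∈ G ∧
      (evalGL t γ : Matrix (Fin n) (Fin n) K) =
        ∑ j ∈ Finset.range (n + 1), ((j.factorial : K)⁻¹ * t ^ j) • N ^ j := by
  have h1 := expCurve_mul_expCurve_neg hN hG
  have h2 := expCurve_mul_expCurve_neg hN.neg ((lieAlg G).neg_mem hG)
  rw [neg_neg] at h2
  refine ⟨⟨expCurve N, expCurve (-N), h1, h2⟩, ?_, fun t => ⟨?_, expCurve_map_eval N t⟩⟩
  · ext i j
    have h := congrFun (congrFun (derivative_expCurve hN) i) j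
    have h0 := expCurve_map_eval_zero N
    refine (congrArg (Polynomial.eval 0) h).trans ?_
    rw [Matrix.mul_apply, Polynomial.eval_finsetSum]
    have h0' : ∀ l, ((expCurve N) i l).eval 0 = (1 : Matrix (Fin n) (Fin n) K) i l :=
      fun l => congrFun (congrFun h0 i) l
    simp [h0', Matrix.one_apply]
  · refine hcl.mem_of_vanishing fun p hp => ?_
    rw [← eval_matSubst]
    refine (congrArg (Polynomial.eval t) (matSubst_expCurve_eq_zero hN hG hp)).trans ?_
    simp

end OneParameter

section Additive

variable {n : ℕ}

/-- Left translation by an element of `GL n K`. -/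
noncomputable def leftTrans (g : GL (Fin n) K) : CoordPoly K n →ₐ[K] CoordPoly K n :=
  matSubst (constMat (g : Matrix (Fin n) (Fin n) K) * genMat K n)
    (genInv K n * constMat ((g⁻¹ : GL (Fin n) K) : Matrix (Fin n) (Fin n) K))

theorem eval_leftTrans (A g : GL (Fin n) K) (p : CoordPoly K n) :
    eval (matOf A) (leftTrans g p) = eval (matOf (g * A)) p := by
  induction p using MvPolynomial.induction_on with
  | C r => simp [← algebraMap_eq]
  | add p q hp hq => simp only [map_add, hp, hq]
  | mul_X p v hp =>
    rw [map_mul, map_mul, map_mul, hp]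
    congr 1
    rcases v with ⟨i, j⟩ | ⟨i, j⟩
    · simp [leftTrans, Matrix.mul_apply, genMat, matOf]
    · simp [leftTrans, Matrix.mul_apply, genInv, matOf, -Matrix.coe_units_inv]

theorem leftTrans_leftDer (g : GL (Fin n) K) (A : Matrix (Fin n) (Fin n) K) (p : CoordPoly K n) :
    leftTrans g (leftDer A p) = leftDer A (leftTrans g p) := by
  induction p using MvPolynomial.induction_on with
  | C r => simp [← algebraMap_eq]
  | add p q hp hq => simp only [map_add, hp, hq]
  | mul_X p v hp =>
    simp only [Derivation.leibniz, map_add, map_mul, smul_eq_mul, hp]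
    congr 2
    rcases v with ⟨i, j⟩ | ⟨i, j⟩
    · have h : ∀ k l, leftDer A (genMat K n k l) = (genMat K n * constMat A) k l :=
        fun k l => leftDer_X_inl A k l
      have h1 : ((constMat (g : Matrix (Fin n) (Fin n) K) * genMat K n) * constMat A) i j =
        (constMat (g : Matrix (Fin n) (Fin n) K) * (genMat K n * constMat A)) i j := by
        rw [Matrix.mul_assoc]
      rw [leftDer_X_inl, leftTrans, matSubst_inl, Matrix.mul_apply, Matrix.mul_apply, map_sum,
        map_sum]
      rw [Matrix.mul_apply, Matrix.mul_apply] at h1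
      refine Eq.trans (Finset.sum_congr rfl fun k _ => ?_)
        (h1.trans (Finset.sum_congr rfl fun k _ => ?_))
      · rw [map_mul, genMat, Matrix.of_apply, matSubst_inl]
        simp [← algebraMap_eq]
      · rw [constMat_apply, Derivation.leibniz, derivation_C, smul_zero, add_zero, h, smul_eq_mul]
    · have h : ∀ k l, leftDer A (genInv K n k l) = -(constMat A * genInv K n) k l :=
        fun k l => leftDer_X_inr A k l
      set M := constMat ((g⁻¹ : GL (Fin n) K) : Matrix (Fin n) (Fin n) K) with hM
      have h1 : (constMat A * (genInv K n * M)) i j = ((constMat A * genInv K n) * M) i j := by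
        rw [Matrix.mul_assoc]
      rw [leftDer_X_inr, leftTrans, ← hM, matSubst_inr, Matrix.mul_apply, Matrix.mul_apply, map_neg,
        map_sum, map_sum]
      rw [Matrix.mul_apply, Matrix.mul_apply, ← neg_inj] at h1
      refine Eq.trans (congrArg _ (Finset.sum_congr rfl fun k _ => ?_))
        (h1.trans ?_)
      · rw [map_mul, genInv, Matrix.of_apply, matSubst_inr]
        simp [← algebraMap_eq, hM]
      · rw [← Finset.sum_neg_distrib]
        refine Finset.sum_congr rfl fun k _ => ?_
        rw [hM, constMat_apply, Derivation.leibniz, derivation_C, smul_zero, zero_add, h,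
          smul_eq_mul, mul_neg, mul_comm]

/-- A polynomial function which is additive on a subgroup. -/
def IsAdditiveOn (H : Subgroup (GL (Fin n) K)) (p : CoordPoly K n) : Prop :=
  ∀ A ∈ H, ∀ B ∈ H, eval (matOf (A * B)) p = eval (matOf A) p + eval (matOf B) p

/-- The differential at the identity of a polynomial function. -/
noncomputable def differential (p : CoordPoly K n) : Matrix (Fin n) (Fin n) K →ₗ[K] K where
  toFun A := eval (matOf 1) (leftDer A p)
  map_add' A B := by rw [leftDer_add, Derivation.add_apply, map_add]
  map_smul' c A := by rw [leftDer_smul, Derivation.smul_apply, smul_eval, RingHom.id_apply,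
    smul_eq_mul]

theorem differential_apply (p : CoordPoly K n) (A : Matrix (Fin n) (Fin n) K) :
    differential p A = eval (matOf 1) (leftDer A p) := rfl

namespace IsAdditiveOn

variable {H : Subgroup (GL (Fin n) K)} {p : CoordPoly K n}

theorem leftTrans_sub_mem (hp : IsAdditiveOn H p) {g : GL (Fin n) K} (hg : g ∈ H) :
    leftTrans g p - p - C (eval (matOf g) p) ∈ vanishing (H : Set (GL (Fin n) K)) := by
  intro A hA
  rw [map_sub, map_sub, eval_leftTrans, eval_C, hp g hg A hA]
  ring

theorem rightTrans_sub_mem (hp : IsAdditiveOn H p) {g : GL (Fin n) K} (hg : g ∈ H) :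
    rightTrans g p - p - C (eval (matOf g) p) ∈ vanishing (H : Set (GL (Fin n) K)) := by
  intro A hA
  rw [map_sub, map_sub, eval_rightTrans, eval_C, hp A hA g hg]
  ring

theorem eval_leftDer (hp : IsAdditiveOn H p) {A : Matrix (Fin n) (Fin n) K} (hA : A ∈ lieAlg H)
    {g : GL (Fin n) K} (hg : g ∈ H) :
    eval (matOf g) (leftDer A p) = differential p A := by
  have h := mem_lieAlg.1 hA _ (hp.leftTrans_sub_mem hg) 1 H.one_mem
  change eval (matOf 1) (leftDer A _) = 0 at h
  rw [map_sub, derivation_C, sub_zero, map_sub, ← leftTrans_leftDer, map_sub, eval_leftTrans,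
    mul_one, sub_eq_zero] at h
  exact h

theorem differential_conj (hp : IsAdditiveOn H p) {A : Matrix (Fin n) (Fin n) K}
    (hA : A ∈ lieAlg H) {g : GL (Fin n) K} (hg : g ∈ H) :
    differential p ((g : Matrix (Fin n) (Fin n) K) * A *
      ((g⁻¹ : GL (Fin n) K) : Matrix (Fin n) (Fin n) K)) = differential p A := by
  have h := mem_lieAlg.1 (conj_mem_lieAlg hg hA) _ (hp.rightTrans_sub_mem hg) 1 H.one_mem
  set B := (g : Matrix (Fin n) (Fin n) K) * A * ((g⁻¹ : GL (Fin n) K) : Matrix (Fin n) (Fin n) K)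
  have hB : B * (g : Matrix (Fin n) (Fin n) K) = g * A := by
    rw [mul_assoc, Units.inv_mul, mul_one]
  change eval (matOf 1) (leftDer B _) = 0 at h
  rw [map_sub, derivation_C, sub_zero, map_sub, ← rightTrans_leftDer g A B hB, map_sub,
    eval_rightTrans, one_mul, sub_eq_zero, hp.eval_leftDer hA hg] at h
  exact h.symm

theorem differential_conjDiag (hp : IsAdditiveOn H p) {P : GL (Fin n) K} {d : Fin n → K}
    (hd : conjDiag P d ∈ lieAlg H) : differential p (conjDiag P d) = 0 := by
  have key : (leftDer (conjDiag P d) : Module.End K (CoordPoly K n)) (p - 0) ∈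
      vanishing (H : Set (GL (Fin n) K)) := by
    rw [sub_zero]
    refine apply_mem_of_apply_apply_mem ?_ (mem_lieAlg.1 hd) ?_
    · refine iSup_eq_top_of_weightSpace_le (P := P) (fun α => ∑ i, (α i : K) * d i) fun α a ha => ?_
      exact Module.End.mem_eigenspace_iff.2 (leftDer_conjDiag_of_mem ha d)
    · have h := mem_lieAlg.1 hd (leftDer (conjDiag P d) p - C (differential p (conjDiag P d)))
        (fun A hA => by rw [map_sub, eval_C, hp.eval_leftDer hd hA, sub_self])
      change leftDer (conjDiag P d) _ ∈ _ at h
      rw [map_sub, derivation_C, sub_zero] at h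
      exact h
  rw [sub_zero] at key
  exact key 1 H.one_mem

theorem eval_conj_diagGL (hp : IsAdditiveOn H p) {P : GL (Fin n) K} {c : Fin n → Kˣ}
    (hc : P * diagGL c * P⁻¹ ∈ H) : eval (matOf (P * diagGL c * P⁻¹)) p = 0 := by
  set s := P * diagGL c * P⁻¹ with hs
  have hst := rightTrans_mem_vanishing hc
  have hsub : ∀ q, ((rightTrans s).toLinearMap - 1 : Module.End K (CoordPoly K n)) q =
    rightTrans s q - q := fun q => rfl
  have key : ((rightTrans s).toLinearMap - 1 : Module.End K (CoordPoly K n)) p ∈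
      vanishing (H : Set (GL (Fin n) K)) := by
    refine apply_mem_of_apply_apply_mem ?_ (fun x hx => ?_) ?_
    · refine iSup_eq_top_of_weightSpace_le (P := P)
        (fun α => ((∏ i, c i ^ α i : Kˣ) : K) - 1) fun α a ha => ?_
      refine Module.End.mem_eigenspace_iff.2 ?_
      have := Module.End.mem_eigenspace_iff.1 (weightSpace_le_eigenspace c α ha)
      rw [LinearMap.sub_apply, this, sub_smul, one_smul]
      rfl
    · exact Submodule.sub_mem _ (hst x hx) hx
    · rw [hsub, hsub]
      have h := hst _ (hp.rightTrans_sub_mem hc)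
      have h' := Submodule.sub_mem _ h (hp.rightTrans_sub_mem hc)
      rw [AlgHom.toLinearMap_apply, map_sub (rightTrans s), ← algebraMap_eq, AlgHom.commutes] at h'
      convert h' using 1
      ring
  have := key 1 H.one_mem
  rw [hsub, map_sub, eval_rightTrans, one_mul, sub_eq_zero] at this
  rw [this]
  have h1 := hp 1 H.one_mem 1 H.one_mem
  rw [mul_one] at h1
  exact left_eq_add.1 h1

end IsAdditiveOn

end Additive

section GroupJordan

variable {n : ℕ}

theorem coe_conj_diagGL (P : GL (Fin n) K) (c : Fin n → Kˣ) :
    ((P * diagGL c * P⁻¹ : GL (Fin n) K) : Matrix (Fin n) (Fin n) K) =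
      conjDiag P fun i => (c i : K) := rfl

theorem commute_iff_coe {g h : GL (Fin n) K} :
    Commute g h ↔ Commute (g : Matrix (Fin n) (Fin n) K) h := by
  rw [commute_iff_eq, commute_iff_eq, ← Units.val_mul, ← Units.val_mul, Units.val_inj]

theorem exists_conj_diagGL_eq {P : GL (Fin n) K} {d : Fin n → K} (h : IsUnit (conjDiag P d)) :
    ∃ c : Fin n → Kˣ, ((P * diagGL c * P⁻¹ : GL (Fin n) K) : Matrix (Fin n) (Fin n) K) =
      conjDiag P d := by
  have h1 : IsUnit (Matrix.diagonal d) := by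
    have h2 : conjDiag P d = P * (Matrix.diagonal d * (P⁻¹ : GL (Fin n) K)) := mul_assoc _ _ _
    rwa [h2, Units.isUnit_units_mul, Units.isUnit_mul_units] at h
  rw [Matrix.isUnit_diagonal, Pi.isUnit_iff] at h1
  choose c hc using h1
  refine ⟨c, ?_⟩
  rw [coe_conj_diagGL]
  exact congrArg _ (funext hc)

theorem exists_jordan_group [IsAlgClosed K] (h : GL (Fin n) K) :
    ∃ (P : GL (Fin n) K) (c : Fin n → Kˣ) (u : GL (Fin n) K),
      h = P * diagGL c * P⁻¹ * u ∧ IsNilpotent ((u : Matrix (Fin n) (Fin n) K) - 1) ∧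
        Commute (P * diagGL c * P⁻¹) u := by
  obtain ⟨P, d, N, hN, hA, hc⟩ := exists_jordan (h : Matrix (Fin n) (Fin n) K)
  have hSh := (hc _ (Commute.refl _)).1
  have hNh := (hc _ (Commute.refl _)).2
  have hSN := (hc _ hNh.symm).1
  have hS : conjDiag P d = -N + h := by rw [hA]; abel
  have hu : IsUnit (conjDiag P d) := by
    rw [hS]
    exact hN.neg.isUnit_add_right_of_commute h.isUnit hNh.neg_left
  obtain ⟨c, hc⟩ := exists_conj_diagGL_eq hu
  set s := P * diagGL c * P⁻¹ with hs
  have hsh : Commute s h := commute_iff_coe.2 (hc ▸ hSh)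
  have hsN : Commute (s : Matrix (Fin n) (Fin n) K) N := hc ▸ hSN
  refine ⟨P, c, s⁻¹ * h, by rw [mul_inv_cancel_left], ?_, ?_⟩
  · have : ((s⁻¹ * h : GL (Fin n) K) : Matrix (Fin n) (Fin n) K) - 1 =
        ((s⁻¹ : GL (Fin n) K) : Matrix (Fin n) (Fin n) K) * N := by
      rw [Units.val_mul, hA, ← hc, mul_add, Units.inv_mul, add_sub_cancel_left]
    rw [this]
    exact hsN.units_inv_left.isNilpotent_mul_left hN
  · exact ((Commute.refl s).inv_right).mul_right hsh

theorem IsAdditiveOn.exists_differential_ne_zero [IsAlgClosed K] [CharZero K]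
    {H : Subgroup (GL (Fin n) K)} (hH : IsZClosed (H : Set (GL (Fin n) K))) {p : CoordPoly K n}
    (hp : IsAdditiveOn H p) {h : GL (Fin n) K} (hh : h ∈ H) (hne : eval (matOf h) p ≠ 0) :
    ∃ y ∈ lieAlg H, differential p y ≠ 0 := by
  obtain ⟨P, c, u, rfl, hu, hc⟩ := exists_jordan_group h
  have hs := conj_diagGL_mem_of_mul_mem hH hu hc hh
  have huH : u ∈ H := (H.mul_mem_cancel_left hs).1 hh
  rw [hp _ hs _ huH, hp.eval_conj_diagGL hs, zero_add] at hne
  obtain ⟨γ, hγ⟩ := exists_evalGL_eq_pow hu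
  have h0 : evalGL 0 γ = 1 := by simpa using hγ 0
  refine ⟨velocity γ, velocity_mem_lieAlg h0 fun k => hγ k ▸ H.pow_mem huH k, ?_⟩
  have h1 := hp 1 H.one_mem 1 H.one_mem
  rw [mul_one] at h1
  rw [differential_apply, ← eval_derivative_matSubst h0, map_one, one_mul]
  have : matSubst (γ : Matrix (Fin n) (Fin n) (Polynomial K))
      ((γ⁻¹ : GL (Fin n) (Polynomial K)) : Matrix (Fin n) (Fin n) (Polynomial K)) p =
        Polynomial.X * Polynomial.C (eval (matOf u) p) := by
    refine polynomial_eq_of_natCast_eval_eq fun k => ?_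
    rw [eval_matSubst, hγ, Polynomial.eval_mul, Polynomial.eval_X, Polynomial.eval_C]
    induction k with
    | zero => rw [pow_zero, Nat.cast_zero, zero_mul]; exact left_eq_add.1 h1
    | succ k ih => rw [pow_succ, hp _ (H.pow_mem huH k) _ huH, ih]; push_cast; ring
  rw [this]
  simpa using hne

end GroupJordan

section Torus

variable {n : ℕ}

theorem exists_conjDiag_iff_isDiag {A P : GL (Fin n) K} :
    (∃ d, (A : Matrix (Fin n) (Fin n) K) = conjDiag P d) ↔
      Matrix.IsDiag ((P⁻¹ * A * P : GL (Fin n) K) : Matrix (Fin n) (Fin n) K) := by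
  constructor
  · rintro ⟨d, h⟩
    have : ((P⁻¹ * A * P : GL (Fin n) K) : Matrix (Fin n) (Fin n) K) = Matrix.diagonal d := by
      rw [Units.val_mul, Units.val_mul, mul_assoc, eq_conjDiag_iff.1 h,
        ← mul_assoc, Units.inv_mul, one_mul]
    rw [this]
    exact Matrix.isDiag_diagonal d
  · intro h
    refine ⟨((P⁻¹ * A * P : GL (Fin n) K) : Matrix (Fin n) (Fin n) K).diag, eq_conjDiag_iff.2 ?_⟩
    rw [h.diagonal_diag, ← Units.val_mul, ← Units.val_mul, mul_assoc P⁻¹, mul_inv_cancel_left]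

theorem isTorus_iff [IsAlgClosed K] {T : Subgroup (GL (Fin n) K)} :
    IsTorus T ↔ IsZClosed (T : Set (GL (Fin n) K)) ∧ IsConnectedSG T ∧
      ∃ P : GL (Fin n) K, ∀ A ∈ T, ∃ d, (A : Matrix (Fin n) (Fin n) K) = conjDiag P d := by
  rw [IsTorus]
  refine and_congr_right fun _ => and_congr_right fun _ => ⟨?_, ?_⟩
  · rintro ⟨g, hg⟩
    let e := RingEquiv.ofBijective _
      (IsAlgClosed.algebraMap_bijective_of_isIntegral (k := K) (K := AlgebraicClosure K))
    let σ : AlgebraicClosure K →+* K := e.symm.toRingHom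
    have hσ : ∀ x, σ (algebraMap K (AlgebraicClosure K) x) = x := fun x => e.symm_apply_apply x
    have hbc : ∀ A : GL (Fin n) K, Matrix.GeneralLinearGroup.map σ (glBaseChange A) = A := by
      intro A
      ext i j
      exact hσ _
    refine ⟨(Matrix.GeneralLinearGroup.map σ g)⁻¹, fun A hA => exists_conjDiag_iff_isDiag.2 ?_⟩
    rw [inv_inv]
    nth_rw 1 [← hbc A]
    rw [← map_mul, ← map_inv, ← map_mul]
    intro i j hij
    change σ _ = 0
    rw [hg A hA hij, map_zero]
  · rintro ⟨P, hP⟩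
    refine ⟨glBaseChange P⁻¹, fun A hA => ?_⟩
    rw [← map_mul, ← map_inv, ← map_mul, inv_inv]
    intro i j hij
    change algebraMap K (AlgebraicClosure K) _ = 0
    rw [exists_conjDiag_iff_isDiag.1 (hP A hA) hij, map_zero]

/-- Conjugation by an invertible matrix, as a linear endomorphism. -/
def conjEnd (g : GL (Fin n) K) : Module.End K (Matrix (Fin n) (Fin n) K) :=
  LinearMap.mulLeft K (g : Matrix (Fin n) (Fin n) K) *
    LinearMap.mulRight K ((g⁻¹ : GL (Fin n) K) : Matrix (Fin n) (Fin n) K)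

theorem conjEnd_apply (g : GL (Fin n) K) (A : Matrix (Fin n) (Fin n) K) :
    conjEnd g A = (g : Matrix (Fin n) (Fin n) K) * A *
      ((g⁻¹ : GL (Fin n) K) : Matrix (Fin n) (Fin n) K) := (mul_assoc _ _ _).symm

theorem conjEnd_mul (g h : GL (Fin n) K) : conjEnd (g * h) = conjEnd g * conjEnd h := by
  refine LinearMap.ext fun A => ?_
  rw [Module.End.mul_apply, conjEnd_apply, conjEnd_apply, conjEnd_apply, _root_.mul_inv_rev,
    Units.val_mul, Units.val_mul]
  simp only [mul_assoc]

theorem conjEnd_apply_eq_self_iff {g : GL (Fin n) K} {A : Matrix (Fin n) (Fin n) K} :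
    conjEnd g A = A ↔ Commute (g : Matrix (Fin n) (Fin n) K) A := by
  rw [conjEnd_apply, Units.mul_inv_eq_iff_eq_mul]
  exact Iff.rfl

theorem iSup_eigenspace_conjEnd {P t : GL (Fin n) K} {d : Fin n → K}
    (h : (t : Matrix (Fin n) (Fin n) K) = conjDiag P d) :
    ⨆ μ, Module.End.eigenspace (conjEnd t) μ = ⊤ := by
  obtain ⟨c, hc⟩ := exists_conj_diagGL_eq (h ▸ t.isUnit)
  rw [← h, Units.val_inj] at hc
  rw [eq_top_iff]
  intro A _
  obtain ⟨B, rfl⟩ : ∃ B, A = conjEnd P B :=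
    ⟨conjEnd P⁻¹ A, by rw [← Module.End.mul_apply, ← conjEnd_mul, mul_inv_cancel, conjEnd_apply]; simp⟩
  rw [Matrix.matrix_eq_sum_single B, map_sum]
  refine Submodule.sum_mem _ fun i _ => ?_
  rw [map_sum]
  refine Submodule.sum_mem _ fun j _ => ?_
  refine Submodule.mem_iSup_of_mem ((c i : K) * ((c j)⁻¹ : Kˣ)) ?_
  refine Module.End.mem_eigenspace_iff.2 ?_
  rw [← Module.End.mul_apply, ← conjEnd_mul, ← hc, inv_mul_cancel_right, conjEnd_mul,
    Module.End.mul_apply, ← map_smul]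
  congr 1
  rw [conjEnd_apply]
  have h1 : ((diagGL c : GL (Fin n) K) : Matrix (Fin n) (Fin n) K) =
    Matrix.diagonal fun i => (c i : K) := rfl
  have h2 : (((diagGL c)⁻¹ : GL (Fin n) K) : Matrix (Fin n) (Fin n) K) =
    Matrix.diagonal fun i => (((c i)⁻¹ : Kˣ) : K) := rfl
  rw [h1, h2]
  ext k l
  rw [Matrix.mul_diagonal, Matrix.diagonal_mul, Matrix.smul_apply, smul_eq_mul, Matrix.single_apply]
  split_ifs with hkl
  · obtain ⟨rfl, rfl⟩ := hkl
    ring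
  · simp

theorem commute_of_forall_eq_conjDiag {T : Subgroup (GL (Fin n) K)} {P : GL (Fin n) K}
    (hP : ∀ t ∈ T, ∃ d, (t : Matrix (Fin n) (Fin n) K) = conjDiag P d) {s t : GL (Fin n) K}
    (hs : s ∈ T) (ht : t ∈ T) : Commute s t := by
  obtain ⟨d, hd⟩ := hP s hs
  obtain ⟨e, he⟩ := hP t ht
  rw [commute_iff_coe, hd, he, commute_iff_eq]
  simp only [conjDiag, mul_assoc, Units.inv_mul_cancel_left]
  simp only [← mul_assoc (Matrix.diagonal _) (Matrix.diagonal _), Matrix.diagonal_mul_diagonal,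
    mul_comm]

theorem eq_zero_of_conj_invariant {T : Subgroup (GL (Fin n) K)} {P : GL (Fin n) K}
    (hP : ∀ t ∈ T, ∃ d, (t : Matrix (Fin n) (Fin n) K) = conjDiag P d)
    {W : Submodule K (Matrix (Fin n) (Fin n) K)} (hW : ∀ t ∈ T, ∀ A ∈ W, conjEnd t A ∈ W)
    {l : Matrix (Fin n) (Fin n) K →ₗ[K] K} (hl : ∀ t ∈ T, ∀ A ∈ W, l (conjEnd t A) = l A)
    (h0 : ∀ A ∈ W, (∀ t ∈ T, Commute (t : Matrix (Fin n) (Fin n) K) A) → l A = 0) :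
    ∀ A ∈ W, l A = 0 := by
  have hcomm : ∀ s ∈ T, ∀ t ∈ T, Commute s t :=
    fun s hs t ht => commute_of_forall_eq_conjDiag hP hs ht
  let θ : T → Module.End K W := fun t => (conjEnd (t : GL (Fin n) K)).restrict (hW t t.2)
  have hθ : ∀ t : T, ⨆ μ, (θ t).eigenspace μ = ⊤ := by
    intro t
    obtain ⟨d, hd⟩ := hP t t.2
    exact Module.End.genEigenspace_restrict_eq_top _ (iSup_eigenspace_conjEnd hd)
  have htop := Module.End.iSup_iInf_maxGenEigenspace_eq_top_of_iSup_maxGenEigenspace_eq_top_of_commute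
    θ (fun s t _ => by
      refine LinearMap.ext fun w => Subtype.ext ?_
      change (conjEnd (s : GL (Fin n) K) * conjEnd (t : GL (Fin n) K)) w =
        (conjEnd (t : GL (Fin n) K) * conjEnd (s : GL (Fin n) K)) w
      rw [← conjEnd_mul, ← conjEnd_mul, (hcomm s s.2 t t.2).eq]) (fun t => by
      rw [← hθ t]
      exact iSup_congr fun μ => maxGenEigenspace_eq_eigenspace_of_iSup_eq_top (hθ t) μ)
  have key : (⊤ : Submodule K W) ≤ LinearMap.ker (l ∘ₗ W.subtype) := by
    rw [← htop]
    refine iSup_le fun χ w hw => ?_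
    have hw' : ∀ t : T, conjEnd (t : GL (Fin n) K) (w : Matrix (Fin n) (Fin n) K) =
        χ t • (w : Matrix (Fin n) (Fin n) K) := by
      intro t
      have h1 := (Submodule.mem_iInf _).1 hw t
      rw [maxGenEigenspace_eq_eigenspace_of_iSup_eq_top (hθ t)] at h1
      exact congrArg Subtype.val (Module.End.mem_eigenspace_iff.1 h1)
    change l w = 0
    by_contra hne
    refine hne (h0 w w.2 fun t ht => conjEnd_apply_eq_self_iff.1 ?_)
    have h1 := hl t ht w w.2
    rw [hw' ⟨t, ht⟩, map_smul, smul_eq_mul] at h1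
    rw [hw' ⟨t, ht⟩, mul_right_cancel₀ hne (h1.trans (one_mul _).symm), one_smul]
  exact fun A hA => key (Submodule.mem_top : (⟨A, hA⟩ : W) ∈ ⊤)

end Torus

section Cocharacters

variable {n : ℕ}

theorem eval_swap (A : GL (Fin n) K) (p : CoordPoly K n) :
    eval (matOf A) (matSubst (genInv K n) (genMat K n) p) = eval (matOf A⁻¹) p := by
  induction p using MvPolynomial.induction_on with
  | C r => simp [← algebraMap_eq]
  | add p q hp hq => simp only [map_add, hp, hq]
  | mul_X p v hp =>
    rw [map_mul, map_mul, map_mul, hp]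
    congr 1
    rcases v with ⟨i, j⟩ | ⟨i, j⟩ <;> simp [genInv, genMat, matOf, -Matrix.coe_units_inv]

/-- The Zariski closure of a subgroup. -/
def zariskiClosure (G : Subgroup (GL (Fin n) K)) : Subgroup (GL (Fin n) K) where
  carrier := {g | ∀ p ∈ vanishing (G : Set (GL (Fin n) K)), eval (matOf g) p = 0}
  one_mem' p hp := hp 1 G.one_mem
  mul_mem' {g h} hg hh p hp := by
    rw [← eval_rightTrans]
    refine hg _ fun A hA => ?_
    rw [eval_rightTrans, ← eval_leftTrans]
    refine hh _ fun B hB => ?_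
    rw [eval_leftTrans]
    exact hp _ (G.mul_mem hA hB)
  inv_mem' {g} hg p hp := by
    have h : ∀ A : GL (Fin n) K, eval (matOf A) (matSubst (genInv K n) (genMat K n) p) =
        eval (matOf A⁻¹) p := fun A => eval_swap A p
    rw [← h]
    exact hg _ fun A hA => by rw [h]; exact hp _ (G.inv_mem hA)

theorem isZClosed_zariskiClosure (G : Subgroup (GL (Fin n) K)) :
    IsZClosed (zariskiClosure G : Set (GL (Fin n) K)) := 
  ⟨vanishing (G : Set (GL (Fin n) K)), rfl⟩

theorem le_zariskiClosure (G : Subgroup (GL (Fin n) K)) : G ≤ zariskiClosure G :=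
  fun _ hg _ hp => hp _ hg

theorem zariskiClosure_subset {G : Subgroup (GL (Fin n) K)} {s : Set (GL (Fin n) K)}
    (hs : IsZClosed s) (h : (G : Set (GL (Fin n) K)) ⊆ s) :
    (zariskiClosure G : Set (GL (Fin n) K)) ⊆ s := fun _ hg =>
  hs.mem_of_vanishing fun p hp => hg p fun A hA => hp A (h hA)

/-- A family of invertible matrices depending on a parameter as a rational curve. -/
def IsRationalCurve {ι : Type} (x : ι → K) (A : ι → GL (Fin n) K) : Prop :=
  ∀ p : CoordPoly K n, ∃ q : Polynomial K, ∀ c, eval (matOf (A c)) p = 0 ↔ q.eval (x c) = 0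

theorem IsRationalCurve.forall_mem_or {ι : Type} {x : ι → K} {A : ι → GL (Fin n) K}
    (hA : IsRationalCurve x A) (hx : (Set.range x).Infinite) {s t : Set (GL (Fin n) K)}
    (hs : IsZClosed s) (ht : IsZClosed t) (h : ∀ c, A c ∈ s ∪ t) :
    (∀ c, A c ∈ s) ∨ ∀ c, A c ∈ t := by
  by_contra! hcon
  obtain ⟨⟨a, ha⟩, b, hb⟩ := hcon
  obtain ⟨I, rfl⟩ := hs
  obtain ⟨J, rfl⟩ := ht
  simp only [Set.mem_ofPred_eq, not_forall] at ha hb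
  obtain ⟨p, hp, hpa⟩ := ha
  obtain ⟨p', hp', hpb⟩ := hb
  obtain ⟨q, hq⟩ := hA p
  obtain ⟨q', hq'⟩ := hA p'
  have hz : q * q' = 0 := by
    refine Polynomial.eq_zero_of_infinite_isRoot _ (hx.mono ?_)
    rintro _ ⟨c, rfl⟩
    change (q * q').eval (x c) = 0
    rw [Polynomial.eval_mul, mul_eq_zero, ← hq, ← hq']
    exact (h c).imp (fun h => h p hp) (fun h => h p' hp')
  rcases mul_eq_zero.1 hz with rfl | rfl
  · exact hpa ((hq a).2 Polynomial.eval_zero)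
  · exact hpb ((hq' b).2 Polynomial.eval_zero)

/-- The algebra of Laurent polynomial functions on the units of a field. -/
def laurentFun (K : Type) [Field K] : Subalgebra K (Kˣ → K) where
  carrier := {f | ∃ (q : Polynomial K) (m : ℕ), ∀ c : Kˣ, f c * (c : K) ^ m = q.eval (c : K)}
  mul_mem' := by
    rintro f g ⟨q, m, h⟩ ⟨q', m', h'⟩
    refine ⟨q * q', m + m', fun c => ?_⟩
    rw [Polynomial.eval_mul, ← h, ← h', Pi.mul_apply]
    ring
  add_mem' := by
    rintro f g ⟨q, m, h⟩ ⟨q', m', h'⟩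
    refine ⟨q * Polynomial.X ^ m' + q' * Polynomial.X ^ m, m + m', fun c => ?_⟩
    rw [Polynomial.eval_add, Polynomial.eval_mul, Polynomial.eval_mul, ← h, ← h', Pi.add_apply]
    simp only [Polynomial.eval_pow, Polynomial.eval_X]
    ring
  algebraMap_mem' r := ⟨Polynomial.C r, 0, fun c => by simp⟩

theorem zpow_mem_laurentFun (z : ℤ) : (fun c : Kˣ => ((c ^ z : Kˣ) : K)) ∈ laurentFun K := by
  obtain ⟨m, rfl | rfl⟩ := z.eq_nat_or_neg
  · exact ⟨Polynomial.X ^ m, 0, fun c => by simp⟩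
  · exact ⟨1, m, fun c => by simp⟩

/-- The one parameter multiplicative subgroup with given weights in the basis given by `P`. -/
def cochar (P : GL (Fin n) K) (z : Fin n → ℤ) : Kˣ →* GL (Fin n) K where
  toFun c := P * diagGL (fun i => c ^ z i) * P⁻¹
  map_one' := by
    have : diagGL (fun i => (1 : Kˣ) ^ z i) = 1 := by
      ext1
      simp [diagGL]
    rw [this, mul_one, mul_inv_cancel]
  map_mul' c d := by
    have : diagGL (fun i => (c * d) ^ z i) = diagGL (fun i => c ^ z i) * diagGL fun i => d ^ z i := by
      refine Units.ext ?_
      rw [Units.val_mul]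
      simp only [diagGL, Matrix.diagonal_mul_diagonal, _root_.mul_zpow, Units.val_mul]
    rw [this]
    group

theorem coe_cochar (P : GL (Fin n) K) (z : Fin n → ℤ) (c : Kˣ) :
    (cochar P z c : Matrix (Fin n) (Fin n) K) = conjDiag P fun i => ((c ^ z i : Kˣ) : K) := rfl

theorem isRationalCurve_mul_cochar (g P : GL (Fin n) K) (z : Fin n → ℤ) :
    IsRationalCurve (fun c : Kˣ => (c : K)) fun c => g * cochar P z c := by
  have hconst : ∀ r : K, (fun _ : Kˣ => r) ∈ laurentFun K := (laurentFun K).algebraMap_mem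
  have hdiag : ∀ (A B : Matrix (Fin n) (Fin n) K) (z : Fin n → ℤ) (i j : Fin n),
      (fun c : Kˣ => (A * Matrix.diagonal (fun i => ((c ^ z i : Kˣ) : K)) * B) i j) ∈
        laurentFun K := by
    intro A B z i j
    have : (fun c : Kˣ => (A * Matrix.diagonal (fun i => ((c ^ z i : Kˣ) : K)) * B) i j) =
        ∑ k, (fun c : Kˣ => A i k) * (fun c : Kˣ => ((c ^ z k : Kˣ) : K)) * fun c : Kˣ => B k j := by
      funext c
      rw [Matrix.mul_apply, Finset.sum_apply]
      exact Finset.sum_congr rfl fun k _ => by rw [Matrix.mul_diagonal]; rfl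
    rw [this]
    exact sum_mem fun k _ => mul_mem (mul_mem (hconst _) (zpow_mem_laurentFun _)) (hconst _)
  have key : ∀ p : CoordPoly K n,
      (fun c : Kˣ => eval (matOf (g * cochar P z c)) p) ∈ laurentFun K := by
    intro p
    induction p using MvPolynomial.induction_on with
    | C r => simpa using hconst r
    | add p q hp hq =>
      simp only [map_add]
      exact add_mem hp hq
    | mul_X p v hp =>
      simp only [map_mul, eval_X]
      refine mul_mem hp ?_
      rcases v with ⟨i, j⟩ | ⟨i, j⟩
      · convert hdiag ((g * P : GL (Fin n) K) : Matrix (Fin n) (Fin n) K) (P⁻¹ : GL (Fin n) K) z i j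
          using 2 with c
        simp only [matOf, Sum.elim_inl, Units.val_mul, coe_cochar, conjDiag, mul_assoc]
      · convert hdiag (P : Matrix (Fin n) (Fin n) K) ((g * P)⁻¹ : GL (Fin n) K) (-z) i j
          using 2 with c
        simp only [matOf, Sum.elim_inr]
        rw [_root_.mul_inv_rev, ← map_inv, Units.val_mul, coe_cochar, conjDiag,
          _root_.mul_inv_rev, Units.val_mul]
        simp only [mul_assoc, Pi.neg_apply, _root_.zpow_neg, _root_.inv_zpow]
  intro p
  obtain ⟨q, m, h⟩ := key p
  refine ⟨q, fun c => ?_⟩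
  rw [← h, mul_eq_zero, or_iff_left (pow_ne_zero _ c.ne_zero)]

theorem commute_conjDiag_iff {P : GL (Fin n) K} {d : Fin n → K} {B : Matrix (Fin n) (Fin n) K} :
    Commute (conjDiag P d) B ↔ ∀ i j, conjEnd P⁻¹ B i j ≠ 0 → d i = d j := by
  have h1 : Commute (conjDiag P d) B ↔
      Matrix.diagonal d * conjEnd P⁻¹ B = conjEnd P⁻¹ B * Matrix.diagonal d := by
    rw [conjEnd_apply, conjDiag, inv_inv, commute_iff_eq, ← mul_assoc B, ← mul_assoc B,
      Units.eq_mul_inv_iff_mul_eq]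
    constructor
    · intro h
      rw [mul_assoc _ _ (Matrix.diagonal d)]
      have := congrArg (fun M => ((P⁻¹ : GL (Fin n) K) : Matrix (Fin n) (Fin n) K) * M) h
      simpa only [mul_assoc, Units.inv_mul_cancel_left] using this
    · intro h
      have := congrArg (fun M => (P : Matrix (Fin n) (Fin n) K) * M) h
      simpa only [mul_assoc, Units.mul_inv_cancel_left] using this
  rw [h1, ← Matrix.ext_iff]
  refine forall_congr' fun i => forall_congr' fun j => ?_
  rw [Matrix.diagonal_mul, Matrix.mul_diagonal, mul_comm, mul_eq_mul_left_iff, or_comm,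
    or_iff_not_imp_left]

end Cocharacters

section MaximalTorus

variable {n : ℕ}

theorem zariskiClosure_forall_eq_conjDiag {G : Subgroup (GL (Fin n) K)} {P : GL (Fin n) K}
    (hP : ∀ t ∈ G, ∃ d, (t : Matrix (Fin n) (Fin n) K) = conjDiag P d) :
    ∀ t ∈ zariskiClosure G, ∃ d, (t : Matrix (Fin n) (Fin n) K) = conjDiag P d := by
  intro t ht
  rw [exists_conjDiag_iff_isDiag]
  intro i j hij
  have heval : ∀ A : GL (Fin n) K, eval (matOf A) ((constMat ((P⁻¹ : GL (Fin n) K) :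
      Matrix (Fin n) (Fin n) K) * genMat K n * constMat (P : Matrix (Fin n) (Fin n) K)) i j) =
      ((P⁻¹ * A * P : GL (Fin n) K) : Matrix (Fin n) (Fin n) K) i j := by
    intro A
    simp [Matrix.mul_apply, genMat, matOf, -Matrix.coe_units_inv]
  rw [← heval]
  refine ht _ fun A hA => ?_
  rw [heval]
  exact exists_conjDiag_iff_isDiag.1 (hP A hA) hij

/-- The product of a subgroup with a commuting one parameter subgroup. -/
def mulRange (T : Subgroup (GL (Fin n) K)) (l : Kˣ →* GL (Fin n) K)
    (h : ∀ t ∈ T, ∀ c, Commute t (l c)) : Subgroup (GL (Fin n) K) where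
  carrier := {g | ∃ t ∈ T, ∃ c, g = t * l c}
  one_mem' := ⟨1, T.one_mem, 1, by simp⟩
  mul_mem' := by
    rintro _ _ ⟨s, hs, c, rfl⟩ ⟨t, ht, d, rfl⟩
    refine ⟨s * t, T.mul_mem hs ht, c * d, ?_⟩
    rw [map_mul, mul_assoc, ← mul_assoc (l c), ← (h t ht c).eq]
    group
  inv_mem' := by
    rintro _ ⟨t, ht, c, rfl⟩
    refine ⟨t⁻¹, T.inv_mem ht, c⁻¹, ?_⟩
    rw [map_inv, _root_.mul_inv_rev, ((h t ht c).inv_inv).eq]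

theorem infinite_range_units [CharZero K] : (Set.range fun c : Kˣ => (c : K)).Infinite := by
  refine (Set.infinite_range_of_injective
    (f := fun k : ℕ => ((k + 1 : ℕ) : K)) fun a b h => ?_).mono ?_
  · exact Nat.succ_injective (Nat.cast_injective h)
  · rintro _ ⟨k, rfl⟩
    exact ⟨Units.mk0 _ (Nat.cast_ne_zero.2 k.succ_ne_zero), rfl⟩

theorem isConnectedSG_zariskiClosure_mulRange [CharZero K] {T : Subgroup (GL (Fin n) K)}
    (hT : IsConnectedSG T) {P : GL (Fin n) K} {z : Fin n → ℤ}
    (h : ∀ t ∈ T, ∀ c, Commute t (cochar P z c)) :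
    IsConnectedSG (zariskiClosure (mulRange T (cochar P z) h)) := by
  set Γ := mulRange T (cochar P z) h with hΓ
  have hle := le_zariskiClosure Γ
  have hTΓ : ∀ t ∈ T, ∀ c, t * cochar P z c ∈ Γ := fun t ht c => ⟨t, ht, c, rfl⟩
  have hTΓ' : ∀ t ∈ T, t ∈ Γ := fun t ht => ⟨t, ht, 1, by simp⟩
  have key : ∀ s t : Set (GL (Fin n) K), IsZClosed s → IsZClosed t →
      (zariskiClosure Γ : Set (GL (Fin n) K)) ⊆ s ∪ t →
      (zariskiClosure Γ : Set (GL (Fin n) K)) ∩ s ∩ t = ∅ → (T : Set (GL (Fin n) K)) ⊆ s →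
      (zariskiClosure Γ : Set (GL (Fin n) K)) ⊆ s := by
    intro s t hs ht hst hdis hTs
    refine zariskiClosure_subset hs ?_
    rintro _ ⟨τ, hτ, c, rfl⟩
    rcases (isRationalCurve_mul_cochar τ P z).forall_mem_or infinite_range_units hs ht
      (fun c => hst (hle (hTΓ τ hτ c))) with h1 | h1
    · exact h1 c
    · have h2 := h1 1
      simp only [map_one, mul_one] at h2
      exact absurd (show τ ∈ (zariskiClosure Γ : Set (GL (Fin n) K)) ∩ s ∩ t from
        ⟨⟨hle (hTΓ' τ hτ), hTs hτ⟩, h2⟩) (by rw [hdis]; exact Set.notMem_empty _)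
  intro s t hs ht hst hdis
  have hsub : (T : Set (GL (Fin n) K)) ⊆ zariskiClosure Γ := fun τ hτ => hle (hTΓ' τ hτ)
  rcases hT s t hs ht (hsub.trans hst) (Set.subset_eq_empty
    (Set.inter_subset_inter_left _ (Set.inter_subset_inter_left _ hsub)) hdis) with h1 | h1
  · exact Or.inl (key s t hs ht hst hdis h1)
  · refine Or.inr (key t s ht hs (by rwa [Set.union_comm]) ?_ h1)
    rwa [Set.inter_right_comm]

theorem cochar_mem_of_isMaximalTorus [IsAlgClosed K] [CharZero K] {G T : Subgroup (GL (Fin n) K)}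
    (hG : IsZClosed (G : Set (GL (Fin n) K))) (hT : IsMaximalTorus G T) {P : GL (Fin n) K}
    {z : Fin n → ℤ} (h : ∀ t ∈ T, ∀ c, Commute t (cochar P z c)) (hmem : ∀ c, cochar P z c ∈ G)
    (c : Kˣ) : cochar P z c ∈ T := by
  obtain ⟨hTt, hTG, hmax⟩ := hT
  obtain ⟨-, hconn, Q, hQ⟩ := isTorus_iff.1 hTt
  set Γ := mulRange T (cochar P z) h with hΓ
  have hTΓ : T ≤ Γ := fun t ht => ⟨t, ht, 1, by simp⟩
  have hdiag : ∃ R : GL (Fin n) K, ∀ g ∈ Γ, ∃ d, (g : Matrix (Fin n) (Fin n) K) = conjDiag R d := by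
    obtain ⟨R, hR⟩ := exists_conjDiag_of_commute
      (s := {A | (∃ t ∈ T, A = (t : Matrix (Fin n) (Fin n) K)) ∨
        ∃ c, A = (cochar P z c : Matrix (Fin n) (Fin n) K)}) (by
        rintro _ (⟨t, ht, rfl⟩ | ⟨c, rfl⟩)
        · exact ⟨Q, hQ t ht⟩
        · exact ⟨P, _, coe_cochar P z c⟩) (by
        rintro _ (⟨t, ht, rfl⟩ | ⟨c, rfl⟩) _ (⟨t', ht', rfl⟩ | ⟨c', rfl⟩)
        · exact commute_iff_coe.1 (commute_of_forall_eq_conjDiag hQ ht ht')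
        · exact commute_iff_coe.1 (h t ht c')
        · exact commute_iff_coe.1 (h t' ht' c).symm
        · exact commute_iff_coe.1 ((Commute.all c c').map (cochar P z)))
    refine ⟨R, ?_⟩
    rintro _ ⟨t, ht, c, rfl⟩
    obtain ⟨d, hd⟩ := hR _ (Or.inl ⟨t, ht, rfl⟩)
    obtain ⟨e, he⟩ := hR _ (Or.inr ⟨c, rfl⟩)
    refine ⟨fun i => d i * e i, ?_⟩
    rw [Units.val_mul, hd, he]
    simp only [conjDiag, mul_assoc, Units.inv_mul_cancel_left]
    rw [← Matrix.diagonal_mul_diagonal, mul_assoc]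
  obtain ⟨R, hR⟩ := hdiag
  have h1 : IsTorus (zariskiClosure Γ) := isTorus_iff.2 ⟨isZClosed_zariskiClosure Γ,
    isConnectedSG_zariskiClosure_mulRange hconn h, R, zariskiClosure_forall_eq_conjDiag hR⟩
  have h2 : zariskiClosure Γ ≤ G := by
    refine zariskiClosure_subset hG ?_
    rintro _ ⟨t, ht, c, rfl⟩
    exact G.mul_mem (hTG ht) (hmem c)
  rw [← hmax _ h1 h2 (hTΓ.trans (le_zariskiClosure Γ))]
  exact le_zariskiClosure Γ ⟨1, T.one_mem, c, (one_mul _).symm⟩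

theorem exists_common_denominator {ι : Type*} [Fintype ι] (q : ι → ℚ) :
    ∃ m : ℚ, m ≠ 0 ∧ ∀ i, ∃ z : ℤ, m * q i = z := by
  classical
  refine ⟨∏ i, ((q i).den : ℚ), Finset.prod_ne_zero_iff.2 fun i _ => by simp, fun i => ?_⟩
  refine ⟨(∏ j ∈ Finset.univ.erase i, ((q j).den : ℤ)) * (q i).num, ?_⟩
  rw [← Finset.mul_prod_erase _ _ (Finset.mem_univ i), mul_right_comm, Rat.den_mul_eq_num]
  push_cast
  ring

theorem commute_semisimple_of_isMaximalTorus [IsAlgClosed K] [CharZero K]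
    {G T : Subgroup (GL (Fin n) K)} (hG : IsZClosed (G : Set (GL (Fin n) K)))
    (hT : IsMaximalTorus G T) {P : GL (Fin n) K} {d : Fin n → K} {N : Matrix (Fin n) (Fin n) K}
    (hN : IsNilpotent N) (hc : Commute (conjDiag P d) N) (hmem : conjDiag P d + N ∈ lieAlg G)
    (hST : ∀ t ∈ T, Commute (conjDiag P d) (t : Matrix (Fin n) (Fin n) K))
    {B : Matrix (Fin n) (Fin n) K} (hB : ∀ t ∈ T, Commute (t : Matrix (Fin n) (Fin n) K) B) :
    Commute (conjDiag P d) B := by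
  rw [commute_conjDiag_iff]
  intro i j hij
  rw [← sub_eq_zero, ← Module.forall_dual_apply_eq_zero_iff ℚ]
  intro f
  obtain ⟨m, hm, hz⟩ := exists_common_denominator fun i => f (d i)
  choose z hz using hz
  have hcT : ∀ t ∈ T, ∀ c, Commute t (cochar P z c) := by
    intro t ht c
    rw [commute_iff_coe, coe_cochar]
    refine Commute.symm (commute_conjDiag_iff.2 fun k l hkl => ?_)
    have h1 := commute_conjDiag_iff.1 (hST t ht) k l hkl
    have h2 : z k = z l := by
      have : (z k : ℚ) = z l := by rw [← hz, ← hz, h1]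
      exact_mod_cast this
    rw [h2]
  have hmem' := cochar_mem_of_isMaximalTorus hG hT hcT
    (fun c => conj_diagGL_zpow_mem hG hN hc hmem (m • f) hz c)
  have h2 := hB _ (hmem' (Units.mk0 2 two_ne_zero))
  rw [coe_cochar] at h2
  have h3 := commute_conjDiag_iff.1 h2 i j hij
  have h4 : z i = z j := by
    rw [Units.val_inj] at h3
    have h5 : ((2 : ℚ) ^ z i : ℚ) = 2 ^ z j := by
      have := congrArg (Units.val) h3
      rw [Units.val_zpow_eq_zpow_val, Units.val_zpow_eq_zpow_val, Units.val_mk0] at this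
      exact_mod_cast (algebraMap ℚ K).injective (by simpa using this)
    exact zpow_right_injective₀ (by norm_num) (by norm_num) h5
  have h6 : m * f (d i) = m * f (d j) := by rw [hz, hz, h4]
  rw [map_sub, mul_left_cancel₀ hm h6, sub_self]

end MaximalTorus

section LieTheory

attribute [local instance] LieRing.ofAssociativeRing

theorem trace_mul_eq_zero_of_isNilpotent {V : Type*} [AddCommGroup V] [Module K V]
    [FiniteDimensional K V] [IsAlgClosed K] [CharZero K] (L : LieSubalgebra K (Module.End K V))
    [LieRing.IsNilpotent L] {x y : Module.End K V} (hx : x ∈ L) (hy : y ∈ L)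
    (hxn : IsNilpotent x) : LinearMap.trace K V (x * y) = 0 := by
  have h := LieModule.traceForm_eq_sum_finrank_nsmul_mul K L V ⟨x, hx⟩ ⟨y, hy⟩
  rw [LieModule.traceForm_apply_apply] at h
  refine h.trans (Finset.sum_eq_zero fun χ _ => ?_)
  have h0 : χ ⟨x, hx⟩ = 0 := 
    LieModule.Weight.apply_eq_zero_of_isNilpotent (R := K) (L := L) (M := V) ⟨x, hx⟩ hxn χ
  rw [h0, zero_mul, smul_zero]

/-- A Lie algebra of matrices as a Lie algebra of endomorphisms of the space of column vectors. -/
def matLieToEnd {n : ℕ} (L : LieSubalgebra K (Matrix (Fin n) (Fin n) K)) :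
    LieSubalgebra K (Module.End K (Fin n → K)) :=
  { L.toSubmodule.map (Matrix.toLinAlgEquiv' (R := K) (n := Fin n)).toLinearMap with
    lie_mem' := by
      rintro _ _ ⟨a, ha, rfl⟩ ⟨b, hb, rfl⟩
      exact ⟨⁅a, b⁆, L.lie_mem ha hb, by simp [LieRing.of_associative_ring_bracket]⟩ }

theorem trace_mul_eq_zero_of_commute_sub [IsAlgClosed K] [CharZero K] {n : ℕ}
    (L : LieSubalgebra K (Matrix (Fin n) (Fin n) K))
    (hL : ∀ x ∈ L, ∃ N, IsNilpotent N ∧ ∀ y ∈ L, Commute (x - N) y)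
    {x y : Matrix (Fin n) (Fin n) K} (hx : x ∈ L) (hy : y ∈ L)
    (hxn : IsNilpotent x) : trace (x * y) = 0 := by
  let e := Matrix.toLinAlgEquiv' (R := K) (n := Fin n)
  let L' := matLieToEnd L
  have hmem : ∀ a ∈ L, e a ∈ L' := fun a ha => ⟨a, ha, rfl⟩
  have hnil : LieRing.IsNilpotent L' := by
    refine (LieAlgebra.isNilpotent_iff_forall (R := K)).2 ?_
    rintro ⟨_, a, ha, rfl⟩
    obtain ⟨N, hN, hc⟩ := hL a ha
    obtain ⟨k, hk⟩ := LieAlgebra.ad_nilpotent_of_nilpotent (R := K) (hN.map e)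
    refine ⟨k, ?_⟩
    refine Module.End.submodule_pow_eq_zero_of_pow_eq_zero (N := L'.toSubmodule) ?_ hk
    ext ⟨_, b, hb, rfl⟩ : 1
    have h1 := (hc b hb).eq
    have h2 : a * b - b * a = N * b - b * N := by
      rw [sub_mul, mul_sub] at h1
      rw [sub_eq_sub_iff_add_eq_add] at h1 ⊢
      rw [h1, add_comm]
    have h3 := congrArg e h2
    rw [map_sub, map_sub, map_mul, map_mul, map_mul, map_mul] at h3
    exact h3.symm
  have h := trace_mul_eq_zero_of_isNilpotent L' (hmem x hx) (hmem y hy) (hxn.map e)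
  rw [← map_mul] at h
  rw [← h]
  exact (Matrix.trace_toLin'_eq (x * y)).symm

/-- Engel's theorem in associative form. -/
theorem exists_pow_eq_bot_of_isNilpotent {n : ℕ} (R : Submodule K (Matrix (Fin n) (Fin n) K))
    (hlie : ∀ x ∈ R, ∀ y ∈ R, x * y - y * x ∈ R) (hL : ∀ x ∈ R, IsNilpotent x) :
    ∃ m, R ^ m = ⊥ := by
  let L : LieSubalgebra K (Matrix (Fin n) (Fin n) K) :=
    { R with lie_mem' := fun {x y} hx hy => hlie x hx y hy }
  let e := Matrix.toLinAlgEquiv' (R := K) (n := Fin n)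
  have hnil : LieModule.IsNilpotent (matLieToEnd L) (Fin n → K) := by
    refine (LieModule.isNilpotent_iff_forall (R := K)).2 ?_
    rintro ⟨_, a, ha, rfl⟩
    exact (hL a ha).map e
  obtain ⟨m, hm⟩ := (LieModule.isNilpotent_iff K (matLieToEnd L) (Fin n → K)).1 hnil
  have key : ∀ k, ∀ x ∈ R ^ k, ∀ v,
      e x v ∈ LieModule.lowerCentralSeries K (matLieToEnd L) (Fin n → K) k := by
    intro k
    induction k with
    | zero => exact fun x _ v => LieSubmodule.mem_top _
    | succ k ih =>
      intro x hx
      rw [pow_succ'] at hx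
      refine Submodule.mul_induction_on hx (fun a ha b hb v => ?_) fun a b ha hb v => ?_
      · rw [LieModule.lowerCentralSeries_succ, map_mul]
        exact LieSubmodule.lie_mem_lie (x := (⟨e a, a, ha, rfl⟩ : matLieToEnd L))
          (LieSubmodule.mem_top _) (ih b hb v)
      · rw [map_add]
        exact add_mem (ha v) (hb v)
  refine ⟨m, (Submodule.eq_bot_iff _).2 fun x hx => e.injective ?_⟩
  rw [map_zero]
  refine LinearMap.ext fun v => ?_
  have h := key m x hx v
  rw [hm] at h
  simpa using h

theorem trace_mul_eq_zero_of_isMaximalTorus [IsAlgClosed K] [CharZero K] {n : ℕ}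
    {G T : Subgroup (GL (Fin n) K)} (hG : IsZClosed (G : Set (GL (Fin n) K)))
    (hT : IsMaximalTorus G T) {x y : Matrix (Fin n) (Fin n) K} (hx : x ∈ lieAlg G)
    (hxT : ∀ t ∈ T, Commute (t : Matrix (Fin n) (Fin n) K) x) (hy : y ∈ lieAlg G)
    (hyT : ∀ t ∈ T, Commute (t : Matrix (Fin n) (Fin n) K) y) (hxn : IsNilpotent x) :
    trace (x * y) = 0 := by
  let L : LieSubalgebra K (Matrix (Fin n) (Fin n) K) :=
    { carrier := {z | z ∈ lieAlg G ∧ ∀ t ∈ T, Commute (t : Matrix (Fin n) (Fin n) K) z}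
      add_mem' := fun ha hb => ⟨add_mem ha.1 hb.1, fun t ht => (ha.2 t ht).add_right (hb.2 t ht)⟩
      zero_mem' := ⟨zero_mem _, fun t _ => Commute.zero_right _⟩
      smul_mem' := fun c _ ha =>
        ⟨Submodule.smul_mem _ c ha.1, fun t ht => (ha.2 t ht).smul_right c⟩
      lie_mem' := fun ha hb => ⟨lie_mem_lieAlg ha.1 hb.1, fun t ht =>
        ((ha.2 t ht).mul_right (hb.2 t ht)).sub_right ((hb.2 t ht).mul_right (ha.2 t ht))⟩ }
  refine trace_mul_eq_zero_of_commute_sub L ?_ ⟨hx, hxT⟩ ⟨hy, hyT⟩ hxn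
  rintro z ⟨hz, hzT⟩
  obtain ⟨P, d, N, hN, rfl, hc⟩ := exists_jordan z
  refine ⟨N, hN, fun b hb => ?_⟩
  rw [add_sub_cancel_right]
  have hSN : Commute (conjDiag P d) N := by
    simpa using (hc _ (Commute.refl _)).1.sub_right (Commute.refl (conjDiag P d))
  exact commute_semisimple_of_isMaximalTorus hG hT hN hSN hz
    (fun t ht => (hc _ (hzT t ht).symm).1) hb.2

end LieTheory

section Orthogonal

variable {n : ℕ}

theorem mem_lieAlg_of_le_of_isNilpotent [CharZero K] {H G : Subgroup (GL (Fin n) K)} (hHG : H ≤ G)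
    (hH : IsZClosed (H : Set (GL (Fin n) K))) {N : Matrix (Fin n) (Fin n) K} (hN : IsNilpotent N)
    (hmem : N ∈ lieAlg H) : N ∈ lieAlg G := by
  obtain ⟨γ, rfl, hγ⟩ := exists_exponential_curve hH hN hmem
  refine velocity_mem_lieAlg ?_ fun k => hHG (hγ _).1
  refine Units.ext ((hγ 0).2.trans ?_)
  rw [Finset.sum_range_succ']
  simp

/-- A nontrivial additive character of `H` produces a nonzero nilpotent element of the Lie algebra
of `H` orthogonal to the Lie algebra of `G` for the trace form. -/
theorem IsAdditiveOn.exists_isNilpotent_orthogonal [IsAlgClosed K] [CharZero K]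
    {G H T : Subgroup (GL (Fin n) K)} (hG : IsZClosed (G : Set (GL (Fin n) K)))
    (hH : IsZClosed (H : Set (GL (Fin n) K))) (hHG : H ≤ G) (hT : IsMaximalTorus G T)
    (hTH : T ≤ H) {p : CoordPoly K n} (hp : IsAdditiveOn H p) {h : GL (Fin n) K} (hh : h ∈ H)
    (hne : eval (matOf h) p ≠ 0) :
    ∃ N ∈ lieAlg G, N ≠ 0 ∧ IsNilpotent N ∧ ∀ z ∈ lieAlg G, trace (N * z) = 0 := by
  obtain ⟨P, hP⟩ := (isTorus_iff.1 hT.1).2.2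
  have hy : ∃ y ∈ lieAlg H, (∀ t ∈ T, Commute (t : Matrix (Fin n) (Fin n) K) y) ∧
      differential p y ≠ 0 := by
    by_contra! hcon
    obtain ⟨y, hy, hy0⟩ := hp.exists_differential_ne_zero hH hh hne
    refine hy0 (eq_zero_of_conj_invariant hP (W := lieAlg H) (l := differential p) ?_ ?_ hcon y hy)
    · exact fun t ht A hA => conjEnd_apply t A ▸ conj_mem_lieAlg (hTH ht) hA
    · intro t ht A hA
      rw [conjEnd_apply]
      exact hp.differential_conj hA (hTH ht)
  obtain ⟨y, hy, hyT, hy0⟩ := hy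
  obtain ⟨P', d, N, hN, rfl, hc⟩ := exists_jordan y
  have hSN : Commute (conjDiag P' d) N := by
    simpa using (hc _ (Commute.refl _)).1.sub_right (Commute.refl (conjDiag P' d))
  have hS := conjDiag_mem_lieAlg hN hSN hy
  have hNH : N ∈ lieAlg H := by simpa using sub_mem hy hS
  have hNG := mem_lieAlg_of_le_of_isNilpotent hHG hH hN hNH
  have hNT : ∀ t ∈ T, Commute (t : Matrix (Fin n) (Fin n) K) N :=
    fun t ht => (hc _ (hyT t ht).symm).2.symm
  refine ⟨N, hNG, ?_, hN, ?_⟩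
  · rintro rfl
    rw [add_zero] at hy0
    exact hy0 (hp.differential_conjDiag hS)
  · refine eq_zero_of_conj_invariant hP (W := lieAlg G)
      (l := Matrix.traceLinearMap (Fin n) K K ∘ₗ LinearMap.mulLeft K N) ?_ ?_ ?_
    · exact fun t ht A hA => conjEnd_apply t A ▸ conj_mem_lieAlg (hT.2.1 ht) hA
    · intro t ht A hA
      have h1 := (hNT t ht).eq
      have h2 : (t : Matrix (Fin n) (Fin n) K)⁻¹ * t = 1 := by
        rw [← Matrix.coe_units_inv, ← Units.val_mul, inv_mul_cancel, Units.val_one]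
      simp only [LinearMap.comp_apply, LinearMap.mulLeft_apply, Matrix.traceLinearMap_apply,
        conjEnd_apply, Matrix.coe_units_inv]
      rw [← mul_assoc, ← mul_assoc, ← h1, Matrix.trace_mul_comm, ← mul_assoc, ← mul_assoc, h2,
        one_mul]
    · exact fun A hA hAT => trace_mul_eq_zero_of_isMaximalTorus hG hT hNG hNT hA hAT hN

end Orthogonal

section TraceRadical

variable {n : ℕ}

/-- The radical of the trace form on the Lie algebra of `G`. -/
noncomputable def traceRadical (G : Subgroup (GL (Fin n) K)) :
    Submodule K (Matrix (Fin n) (Fin n) K) where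
  carrier := {x | x ∈ lieAlg G ∧ ∀ z ∈ lieAlg G, trace (x * z) = 0}
  add_mem' := fun ha hb => ⟨add_mem ha.1 hb.1, fun z hz => by
    rw [add_mul, trace_add, ha.2 z hz, hb.2 z hz, add_zero]⟩
  zero_mem' := ⟨zero_mem _, fun z _ => by rw [zero_mul, trace_zero]⟩
  smul_mem' := fun c a ha => ⟨Submodule.smul_mem _ c ha.1, fun z hz => by
    rw [smul_mul_assoc, trace_smul, ha.2 z hz, smul_zero]⟩

theorem lie_mem_traceRadical {G : Subgroup (GL (Fin n) K)} {x y : Matrix (Fin n) (Fin n) K}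
    (hx : x ∈ traceRadical G) (hy : y ∈ traceRadical G) : ⁅x, y⁆ ∈ traceRadical G := by
  refine ⟨lie_mem_lieAlg hx.1 hy.1, fun z hz => ?_⟩
  have h := hx.2 _ (lie_mem_lieAlg hy.1 hz)
  rw [Ring.lie_def, mul_sub, trace_sub] at h
  rw [Ring.lie_def, sub_mul, trace_sub, mul_assoc, h.symm, mul_assoc, Matrix.trace_mul_comm y,
    mul_assoc]

theorem conjEnd_mem_traceRadical {G : Subgroup (GL (Fin n) K)} {g : GL (Fin n) K} (hg : g ∈ G)
    {x : Matrix (Fin n) (Fin n) K} (hx : x ∈ traceRadical G) : conjEnd g x ∈ traceRadical G := by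
  refine ⟨conjEnd_apply g x ▸ conj_mem_lieAlg hg hx.1, fun z hz => ?_⟩
  have h := hx.2 _ (conj_mem_lieAlg (inv_mem hg) hz)
  rw [inv_inv] at h
  rw [conjEnd_apply, mul_assoc, mul_assoc, Matrix.trace_mul_comm, ← h]
  simp only [mul_assoc]

theorem commute_conjDiag_comp {P : GL (Fin n) K} {d : Fin n → K} {B : Matrix (Fin n) (Fin n) K}
    (h : Commute (conjDiag P d) B) (f : K → K) : Commute (conjDiag P (f ∘ d)) B :=
  commute_conjDiag_iff.2 fun i j hij => congrArg f (commute_conjDiag_iff.1 h i j hij)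

theorem trace_conjDiag_mul_conjDiag (P : GL (Fin n) K) (d e : Fin n → K) :
    trace (conjDiag P d * conjDiag P e) = ∑ i, d i * e i := by
  have h : conjDiag P d * conjDiag P e = (P : Matrix (Fin n) (Fin n) K) *
      (Matrix.diagonal d * Matrix.diagonal e) *
        ((P⁻¹ : GL (Fin n) K) : Matrix (Fin n) (Fin n) K) := by
    simp only [conjDiag, mul_assoc]
    rw [Units.inv_mul_cancel_left]
  rw [h, Matrix.trace_mul_comm, Units.inv_mul_cancel_left, Matrix.diagonal_mul_diagonal,
    Matrix.trace_diagonal]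

theorem isNilpotent_of_mem_traceRadical [IsAlgClosed K] [CharZero K] {G : Subgroup (GL (Fin n) K)}
    {x : Matrix (Fin n) (Fin n) K} (hx : x ∈ traceRadical G) : IsNilpotent x := by
  obtain ⟨P, d, N, hN, rfl, hc⟩ := exists_jordan x
  have hSN : Commute (conjDiag P d) N := by
    simpa using (hc _ (Commute.refl _)).1.sub_right (Commute.refl (conjDiag P d))
  suffices hd : d = 0 by
    have : conjDiag P d = 0 := by simp [conjDiag, hd]
    rwa [this, zero_add]
  have hf : ∀ (f : Module.Dual ℚ K) (i : Fin n), f (d i) = 0 := by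
    intro f
    let F : K →ₗ[ℚ] K := Algebra.linearMap ℚ K ∘ₗ f
    have hF := conjDiag_comp_mem_lieAlg hN hSN hx.1 F
    have h := hx.2 _ hF
    have hnil : IsNilpotent (trace (N * conjDiag P (F ∘ d))) :=
      Matrix.isNilpotent_trace_of_isNilpotent
        ((commute_conjDiag_comp hSN F).symm.isNilpotent_mul_right hN)
    rw [add_mul, trace_add, hnil.eq_zero, add_zero, trace_conjDiag_mul_conjDiag] at h
    have h2 : ∑ i, f (d i) * f (d i) = 0 := by
      have h3 := congrArg f h
      rw [map_sum, map_zero] at h3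
      rw [← h3]
      refine Finset.sum_congr rfl fun i _ => ?_
      have : d i * (F ∘ d) i = f (d i) • d i := by
        rw [Algebra.smul_def, mul_comm]
        rfl
      rw [this, map_smul, smul_eq_mul]
    intro i
    have h4 := (Finset.sum_eq_zero_iff_of_nonneg fun i _ => mul_self_nonneg (f (d i))).1 h2 i
      (Finset.mem_univ i)
    exact mul_self_eq_zero.1 h4
  funext i
  exact (Module.forall_dual_apply_eq_zero_iff ℚ (d i)).1 fun f => hf f i

theorem conjEnd_map_mul (g : GL (Fin n) K) (a b : Matrix (Fin n) (Fin n) K) :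
    conjEnd g (a * b) = conjEnd g a * conjEnd g b := by
  simp only [conjEnd_apply, mul_assoc]
  rw [Units.inv_mul_cancel_left]

/-- The terms of the associative flag generated by a space of matrices. -/
def rightIdealPow (R : Submodule K (Matrix (Fin n) (Fin n) K)) (k : ℕ) :
    Submodule K (Matrix (Fin n) (Fin n) K) := R ^ k * ⊤

theorem rightIdealPow_zero (R : Submodule K (Matrix (Fin n) (Fin n) K)) :
    rightIdealPow R 0 = ⊤ := by
  rw [rightIdealPow, pow_zero, one_mul]

theorem rightIdealPow_succ (R : Submodule K (Matrix (Fin n) (Fin n) K)) (k : ℕ) :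
    rightIdealPow R (k + 1) = R * rightIdealPow R k := by
  rw [rightIdealPow, pow_succ', mul_assoc, rightIdealPow]

theorem rightIdealPow_succ_le (R : Submodule K (Matrix (Fin n) (Fin n) K)) (k : ℕ) :
    rightIdealPow R (k + 1) ≤ rightIdealPow R k := by
  rw [rightIdealPow, pow_succ, mul_assoc, rightIdealPow]
  exact mul_le_mul_right le_top _

theorem conjEnd_mem_rightIdealPow {R : Submodule K (Matrix (Fin n) (Fin n) K)} {g : GL (Fin n) K}
    (hg : ∀ x ∈ R, conjEnd g x ∈ R) (k : ℕ) :
    ∀ w ∈ rightIdealPow R k, conjEnd g w ∈ rightIdealPow R k := by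
  induction k with
  | zero => simp [rightIdealPow_zero]
  | succ k ih =>
    intro w hw
    rw [rightIdealPow_succ] at hw ⊢
    refine Submodule.mul_induction_on hw (fun a ha b hb => ?_) fun a b ha hb => ?_
    · rw [conjEnd_map_mul]
      exact Submodule.mul_mem_mul (hg a ha) (ih b hb)
    · rw [map_add]
      exact add_mem ha hb

/-- The matrices shifting the associative flag generated by a space of matrices. -/
def flagShift (R : Submodule K (Matrix (Fin n) (Fin n) K)) :
    Submodule K (Matrix (Fin n) (Fin n) K) where
  carrier := {b | ∀ k, ∀ w ∈ rightIdealPow R k, b * w ∈ rightIdealPow R (k + 1)}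
  add_mem' := fun ha hb k w hw => by
    rw [add_mul]
    exact add_mem (ha k w hw) (hb k w hw)
  zero_mem' := fun k w _ => by
    rw [zero_mul]
    exact zero_mem _
  smul_mem' := fun c a ha k w hw => by
    rw [smul_mul_assoc]
    exact Submodule.smul_mem _ c (ha k w hw)

theorem le_flagShift (R : Submodule K (Matrix (Fin n) (Fin n) K)) : R ≤ flagShift R :=
  fun x hx k w hw => by
    rw [rightIdealPow_succ]
    exact Submodule.mul_mem_mul hx hw

theorem mul_mem_flagShift {R : Submodule K (Matrix (Fin n) (Fin n) K)}
    {a b : Matrix (Fin n) (Fin n) K} (ha : a ∈ flagShift R) (hb : b ∈ flagShift R) :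
    a * b ∈ flagShift R := fun k w hw => by
  rw [mul_assoc]
  exact rightIdealPow_succ_le R _ (ha _ _ (hb k w hw))

theorem conjEnd_mem_flagShift {R : Submodule K (Matrix (Fin n) (Fin n) K)} {g : GL (Fin n) K}
    (hg : ∀ x ∈ R, conjEnd g x ∈ R) (hg' : ∀ x ∈ R, conjEnd g⁻¹ x ∈ R)
    {a : Matrix (Fin n) (Fin n) K} (ha : a ∈ flagShift R) : conjEnd g a ∈ flagShift R :=
  fun k w hw => by
    have h := conjEnd_mem_rightIdealPow hg (k + 1) _
      (ha k _ (conjEnd_mem_rightIdealPow hg' k w hw))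
    rw [conjEnd_map_mul, ← Module.End.mul_apply, ← conjEnd_mul, mul_inv_cancel] at h
    simpa [conjEnd_apply] using h

theorem isNilpotent_of_mem_flagShift {R : Submodule K (Matrix (Fin n) (Fin n) K)} {m : ℕ}
    (hm : R ^ m = ⊥) {a : Matrix (Fin n) (Fin n) K} (ha : a ∈ flagShift R) : IsNilpotent a := by
  have key : ∀ k, a ^ k ∈ rightIdealPow R k := by
    intro k
    induction k with
    | zero => simp [rightIdealPow_zero]
    | succ k ih =>
      rw [pow_succ']
      exact ha k _ ih
  refine ⟨m, ?_⟩
  have h := key m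
  rwa [rightIdealPow, hm, Submodule.bot_mul, Submodule.mem_bot] at h

end TraceRadical

section UnipotentGroup

variable {n : ℕ}

/-- The elements of `G` congruent to the identity modulo a nilpotent algebra of matrices. -/
def unipotentSubgroup (G : Subgroup (GL (Fin n) K)) (B : Submodule K (Matrix (Fin n) (Fin n) K))
    (hB : ∀ a ∈ B, ∀ b ∈ B, a * b ∈ B) : Subgroup (GL (Fin n) K) where
  carrier := {g | g ∈ G ∧ (g : Matrix (Fin n) (Fin n) K) - 1 ∈ B}
  one_mem' := ⟨one_mem G, by simp⟩
  mul_mem' := fun {g h} hg hh => ⟨mul_mem hg.1 hh.1, by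
    have : ((g * h : GL (Fin n) K) : Matrix (Fin n) (Fin n) K) - 1 =
        ((g : Matrix (Fin n) (Fin n) K) - 1) * ((h : Matrix (Fin n) (Fin n) K) - 1) +
          (((g : Matrix (Fin n) (Fin n) K) - 1) + ((h : Matrix (Fin n) (Fin n) K) - 1)) := by
      rw [Units.val_mul]
      noncomm_ring
    rw [this]
    exact add_mem (hB _ hg.2 _ hh.2) (add_mem hg.2 hh.2)⟩
  inv_mem' := fun {g} hg => ⟨inv_mem hg.1, by
    let f : B →ₗ[K] B := (LinearMap.mulLeft K (g : Matrix (Fin n) (Fin n) K)).restrict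
      (fun y hy => by
        have := add_mem (hB _ hg.2 _ hy) hy
        rwa [sub_mul, one_mul, sub_add_cancel] at this)
    have hf : Function.Injective f := fun x y hxy => Subtype.ext <| by
      have h := congrArg Subtype.val hxy
      exact g.isUnit.mul_left_cancel h
    obtain ⟨y, hy⟩ := LinearMap.injective_iff_surjective.1 hf ⟨_, neg_mem hg.2⟩
    have hy' : (g : Matrix (Fin n) (Fin n) K) * y = -((g : Matrix (Fin n) (Fin n) K) - 1) :=
      congrArg Subtype.val hy
    have h2 : ((g⁻¹ : GL (Fin n) K) : Matrix (Fin n) (Fin n) K) - 1 = y := by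
      refine g.isUnit.mul_left_cancel ?_
      rw [hy', mul_sub, Units.mul_inv, mul_one, neg_sub]
    rw [h2]
    exact y.2⟩

variable {G : Subgroup (GL (Fin n) K)} {B : Submodule K (Matrix (Fin n) (Fin n) K)}
  {hB : ∀ a ∈ B, ∀ b ∈ B, a * b ∈ B}

theorem mem_unipotentSubgroup {g : GL (Fin n) K} :
    g ∈ unipotentSubgroup G B hB ↔ g ∈ G ∧ (g : Matrix (Fin n) (Fin n) K) - 1 ∈ B := Iff.rfl

theorem isZClosed_unipotentSubgroup (hG : IsZClosed (G : Set (GL (Fin n) K))) :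
    IsZClosed (unipotentSubgroup G B hB : Set (GL (Fin n) K)) := by
  obtain ⟨I, hI⟩ := hG
  let q : Module.Dual K (Matrix (Fin n) (Fin n) K) → CoordPoly K n := fun l =>
    ∑ i, ∑ j, C (l (Matrix.single i j 1)) * X (Sum.inl (i, j)) - C (l 1)
  have hq : ∀ l (g : GL (Fin n) K),
      eval (matOf g) (q l) = l ((g : Matrix (Fin n) (Fin n) K) - 1) := by
    intro l g
    rw [map_sub, map_sub]
    nth_rewrite 1 [Matrix.matrix_eq_sum_single (g : Matrix (Fin n) (Fin n) K)]
    simp only [map_sum, map_mul, eval_C, eval_X]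
    congr 1
    refine Finset.sum_congr rfl fun i _ => Finset.sum_congr rfl fun j _ => ?_
    rw [← mul_one ((g : Matrix (Fin n) (Fin n) K) i j), ← smul_eq_mul _ (1 : K),
      ← Matrix.smul_single, map_smul, smul_eq_mul]
    exact mul_comm (l (Matrix.single i j 1)) ((g : Matrix (Fin n) (Fin n) K) i j)
  refine ⟨I ∪ q '' {l | ∀ b ∈ B, l b = 0}, ?_⟩
  ext g
  have hgI : g ∈ G ↔ ∀ p ∈ I, eval (matOf g) p = 0 := by
    rw [← SetLike.mem_coe, hI]
    rfl
  rw [SetLike.mem_coe, mem_unipotentSubgroup, hgI]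
  constructor
  · rintro ⟨h1, h2⟩ p (hp | ⟨l, hl, rfl⟩)
    · exact h1 p hp
    · rw [hq]
      exact hl _ h2
  · refine fun h => ⟨fun p hp => h p (Or.inl hp), ?_⟩
    by_contra hnot
    obtain ⟨l, hl, hlB⟩ := Submodule.exists_le_ker_of_notMem hnot
    exact hl ((hq l g).symm.trans (h _ (Or.inr ⟨l, fun b hb => hlB hb, rfl⟩)))

theorem isRationalCurve_evalGL (γ : GL (Fin n) (Polynomial K)) :
    IsRationalCurve id fun t => evalGL t γ := fun p => ⟨_, fun t => by
  rw [← eval_matSubst]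
  rfl⟩

theorem isConnectedSG_of_isNilpotent_sub_one [CharZero K] {U : Subgroup (GL (Fin n) K)}
    (hU : IsZClosed (U : Set (GL (Fin n) K)))
    (h : ∀ u ∈ U, IsNilpotent ((u : Matrix (Fin n) (Fin n) K) - 1)) : IsConnectedSG U := by
  have key : ∀ s t : Set (GL (Fin n) K), IsZClosed s → IsZClosed t →
      (U : Set (GL (Fin n) K)) ⊆ s ∪ t → (U : Set (GL (Fin n) K)) ∩ s ∩ t = ∅ → 1 ∈ s →
      (U : Set (GL (Fin n) K)) ⊆ s := by
    intro s t hs ht hst hdis h1 u hu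
    obtain ⟨γ, hγ⟩ := exists_evalGL_eq_pow (h u hu)
    have hmem := evalGL_mem_of_natCast hU fun k => by
      rw [hγ]
      exact pow_mem hu k
    have h0 : evalGL 0 γ = 1 := by simpa using hγ 0
    have hone : evalGL 1 γ = u := by simpa using hγ 1
    rcases (isRationalCurve_evalGL γ).forall_mem_or (by simpa using Set.infinite_univ) hs ht
      fun t => hst (hmem t) with hc | hc
    · exact hone ▸ hc 1
    · have : (1 : GL (Fin n) K) ∈ (U : Set (GL (Fin n) K)) ∩ s ∩ t :=
        ⟨⟨one_mem U, h1⟩, h0 ▸ hc 0⟩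
      rw [hdis] at this
      exact this.elim
  intro s t hs ht hst hdis
  rcases hst (one_mem U) with h1 | h1
  · exact Or.inl (key s t hs ht hst hdis h1)
  · refine Or.inr (key t s ht hs (Set.union_comm s t ▸ hst) ?_ h1)
    rw [Set.inter_right_comm, hdis]

theorem eq_zero_of_orthogonal_of_isReductive [IsAlgClosed K] [CharZero K] (hG : IsReductive G)
    {N : Matrix (Fin n) (Fin n) K} (hN : IsNilpotent N) (hNG : N ∈ traceRadical G) : N = 0 := by
  obtain ⟨m, hm⟩ := exists_pow_eq_bot_of_isNilpotent (traceRadical G)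
    (fun x hx y hy => lie_mem_traceRadical hx hy) fun x hx => isNilpotent_of_mem_traceRadical hx
  set B := flagShift (traceRadical G) with hBdef
  have hnil : ∀ a ∈ B, IsNilpotent a := fun a ha => isNilpotent_of_mem_flagShift hm ha
  have hB : ∀ a ∈ B, ∀ b ∈ B, a * b ∈ B := fun a ha b hb => mul_mem_flagShift ha hb
  have hcl := isZClosed_unipotentSubgroup (B := B) (hB := hB) hG.1
  have hU : unipotentSubgroup G B hB = ⊥ := by
    refine hG.2.2 _ (fun g hg => hg.1) hcl
      (isConnectedSG_of_isNilpotent_sub_one hcl fun u hu => hnil _ hu.2) ?_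
      fun u hu => isUnipotentElt_of_isNilpotent (hnil _ hu.2)
    intro g hg u hu
    refine ⟨mul_mem (mul_mem hg hu.1) (inv_mem hg), ?_⟩
    have h := conjEnd_mem_flagShift (fun x hx => conjEnd_mem_traceRadical hg hx)
      (fun x hx => conjEnd_mem_traceRadical (inv_mem hg) hx) hu.2
    rwa [conjEnd_apply, mul_sub, mul_one, sub_mul, Units.mul_inv] at h
  obtain ⟨γ, hγN, hγ⟩ := exists_exponential_curve hG.1 hN hNG.1
  have hpow : ∀ j, N ^ (j + 1) ∈ B := by
    intro j
    induction j with
    | zero => simpa using le_flagShift _ hNG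
    | succ j ih =>
      rw [pow_succ]
      exact hB _ ih _ (le_flagShift _ hNG)
  have hγ1 : ∀ t, evalGL t γ = 1 := by
    intro t
    rw [← Subgroup.mem_bot, ← hU, mem_unipotentSubgroup]
    refine ⟨(hγ t).1, ?_⟩
    rw [(hγ t).2, Finset.sum_range_succ']
    simp only [Nat.factorial_zero, Nat.cast_one, inv_one, pow_zero, mul_one, one_smul,
      add_sub_cancel_right]
    exact sum_mem fun j _ => Submodule.smul_mem _ _ (hpow j)
  have hγc : γ = constGL 1 := by
    ext i j : 2
    refine Polynomial.funext fun t => ?_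
    rw [← evalGL_apply, ← evalGL_apply, hγ1, evalGL_constGL]
  rw [← hγN, hγc, velocity_constGL]

end UnipotentGroup

/-- Over an algebraically closed field of characteristic 0, let `H` be a
closed subgroup of a reductive group `G` of maximal reductive rank (containing a maximal torus
of `G`). Then there is no normal closed subgroup `K'` of `H` with `H/K' ≅ G_a`; the quotient
`H/K' ≅ G_a` is encoded by a surjective algebraic homomorphism `H → G_a` with kernel `K'`. -/
theorem no_normal_subgroup_with_ga_quotient
    {K : Type} [Field K] [IsAlgClosed K] [CharZero K] {n : ℕ}
    (G H K' : Subgroup (GL (Fin n) K)) (hG : IsReductive G) (hHG : H ≤ G)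
    (hHcl : IsZClosed (H : Set (GL (Fin n) K)))
    (hT : ∃ T : Subgroup (GL (Fin n) K), IsMaximalTorus G T ∧ T ≤ H)
    (hK'H : K' ≤ H) (hK'cl : IsZClosed (K' : Set (GL (Fin n) K)))
    (hnormal : ∀ h ∈ H, ∀ k ∈ K', h * k * h⁻¹ ∈ K')
    (φ : GaHom H) (hφsurj : Function.Surjective φ.toFun)
    (hker : ∀ A : H, φ.toFun A = 0 ↔ (A : GL (Fin n) K) ∈ K') :
    False := by
  obtain ⟨T, hTmax, hTH⟩ := hT
  obtain ⟨p, hp⟩ := φ.poly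
  obtain ⟨h, hh⟩ := hφsurj 1
  have hadd : IsAdditiveOn H p := fun A hA B hB => by
    have := φ.map_mul ⟨A, hA⟩ ⟨B, hB⟩
    rwa [hp, hp, hp] at this
  have hne : eval (matOf (h : GL (Fin n) K)) p ≠ 0 := by
    rw [← hp, hh]
    exact one_ne_zero
  obtain ⟨N, hNG, hN0, hN, horth⟩ :=
    hadd.exists_isNilpotent_orthogonal hG.1 hHcl hHG hTmax hTH h.2 hne
  exact hN0 (eq_zero_of_orthogonal_of_isReductive hG hN ⟨hNG, horth⟩)
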